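/- Let n > 10 be an integer, p > p_c and α > 0. Suppose v₀ : [0,∞) → ℝ is continuous, nonnegative, and satisfies φ_α(r) − b(r+1)^{−γ} ≤ v₀(r) ≤ φ_α(r) for all r ≥ 0, with some b > 0 and γ ∈ (ν+λ₁, (n−2)/2). Then there exists C > 0 such that every bounded classical radial solution v of (v^p)_t = v_rr + ((n−1)/r)v_r + v^p with initial data v₀ satisfies |v(r,t) − φ_α(r)| ≤ C e^{−κ(γ) t} for all r ≥ 0 and t ≥ 0, where κ(γ) := γ(n−2−γ)/(pL^{p−1}) − 1. -/

import Mathlib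

noncomputable section

open Real Filter Set Asymptotics

/-- `ν = 2/(p-1)`. -/
def nuExp (p : ℝ) : ℝ := 2 / (p - 1)

/-- `L = (ν(n−2−ν))^{1/(p−1)}`. -/
def Lconst (n : ℕ) (p : ℝ) : ℝ := (nuExp p * ((n : ℝ) - 2 - nuExp p)) ^ (1 / (p - 1))

/-- The critical exponent `p_c` for `n > 10`. -/
def pc (n : ℕ) : ℝ :=
  (((n : ℝ) - 2) ^ 2 - 4 * (n : ℝ) + 8 * Real.sqrt ((n : ℝ) - 1)) /
    (((n : ℝ) - 2) * ((n : ℝ) - 10))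

/-- `λ₁ = (n−2−2ν − √((n−2−2ν)² − 8(n−2−ν)))/2`. -/
def lam1 (n : ℕ) (p : ℝ) : ℝ :=
  (((n : ℝ) - 2 - 2 * nuExp p) -
    Real.sqrt (((n : ℝ) - 2 - 2 * nuExp p) ^ 2 - 8 * ((n : ℝ) - 2 - nuExp p))) / 2

/-- `κ(γ) = γ(n−2−γ)/(pL^{p−1}) − 1`. -/
def kappaOf (n : ℕ) (p γ : ℝ) : ℝ :=
  γ * ((n : ℝ) - 2 - γ) / (p * Lconst n p ^ (p - 1)) - 1

/-- `φ` is the (radial profile of the) positive steady state `φ_α` of `Δφ + φ^p = 0`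
with `φ(0) = α`, `φ'(0) = 0`, together with its properties in the supercritical range
`n > 10`, `p > p_c`: positivity, strict monotonicity, the bound `φ(r) ≤ L r^{−ν}`, and the
asymptotic expansion `φ(r) = L r^{−ν} − a r^{−ν−λ₁} + o(r^{−ν−λ₁})` with coefficient `a > 0`. -/
structure IsSteadyStateA (n : ℕ) (p α : ℝ) (φ : ℝ → ℝ) (a : ℝ) : Prop where
  cont : ContinuousOn φ (Set.Ici 0)
  smooth : ContDiffOn ℝ 2 φ (Set.Ioi 0)
  ode : ∀ r > (0 : ℝ), deriv (deriv φ) r + ((n : ℝ) - 1) / r * deriv φ r + φ r ^ p = 0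
  val0 : φ 0 = α
  deriv0 : derivWithin φ (Set.Ici 0) 0 = 0
  pos : ∀ r ≥ (0 : ℝ), 0 < φ r
  anti : StrictAntiOn φ (Set.Ici 0)
  upper : ∀ r > (0 : ℝ), φ r ≤ Lconst n p * r ^ (-nuExp p)
  a_pos : 0 < a
  expansion :
    (fun r => φ r - (Lconst n p * r ^ (-nuExp p) - a * r ^ (-nuExp p - lam1 n p)))
      =o[atTop] fun r => r ^ (-nuExp p - lam1 n p)

/-- `v` is a bounded classical radial solution of
`(v^p)_t = v_rr + ((n−1)/r) v_r + v^p` with initial data `v₀ : [0,∞) → ℝ`: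
nonnegative and continuous on `[0,∞) × [0,∞)`, bounded on `[0,∞) × [0,T]` for every
`T > 0`, `C²` in `r` and `C¹` in `t` for `t > 0` with `∂_r v(0,t) = 0`, satisfying the
equation pointwise for `r > 0`, `t > 0`, and attaining the initial data. -/
structure IsRadialSol (n : ℕ) (p : ℝ) (v : ℝ → ℝ → ℝ) (v₀ : ℝ → ℝ) : Prop where
  nonneg : ∀ r ≥ (0 : ℝ), ∀ t ≥ (0 : ℝ), 0 ≤ v r t
  cont : ContinuousOn (fun q : ℝ × ℝ => v q.1 q.2) (Set.Ici 0 ×ˢ Set.Ici 0)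
  bdd : ∀ T > (0 : ℝ), ∃ M, ∀ r ≥ (0 : ℝ), ∀ t ∈ Set.Icc (0 : ℝ) T, v r t ≤ M
  smooth_r : ∀ t > (0 : ℝ), ContDiffOn ℝ 2 (fun r => v r t) (Set.Ici 0)
  smooth_t : ∀ r ≥ (0 : ℝ), ContDiffOn ℝ 1 (fun s => v r s ^ p) (Set.Ioi (0 : ℝ))
  slope0 : ∀ t > (0 : ℝ), derivWithin (fun r => v r t) (Set.Ici 0) 0 = 0
  pde : ∀ r > (0 : ℝ), ∀ t > (0 : ℝ),
    deriv (fun s => v r s ^ p) t =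
      deriv (deriv fun ρ => v ρ t) r + ((n : ℝ) - 1) / r * deriv (fun ρ => v ρ t) r
        + v r t ^ p
  init : ∀ r ≥ (0 : ℝ), v r 0 = v₀ r

open Topology

lemma aux_params {n : ℕ} (hn : 10 < n) {p : ℝ} (hp : pc n < p) :
    1 < p ∧ 0 < nuExp p ∧ 2 * nuExp p < (n : ℝ) - 2 := by
  have hn' : (11 : ℝ) ≤ n := by exact_mod_cast hn
  have hs : 0 ≤ Real.sqrt ((n : ℝ) - 1) := Real.sqrt_nonneg _
  have hden : 0 < ((n : ℝ) - 2) * ((n : ℝ) - 10) := mul_pos (by linarith) (by linarith)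
  have h1 : 1 + 4 / ((n : ℝ) - 2) < p := by
    refine lt_of_lt_of_le ?_ hp.le
    have : 1 + 4 / ((n : ℝ) - 2) =
        (((n : ℝ) - 2) * ((n : ℝ) - 10) + 4 * ((n : ℝ) - 10)) / (((n : ℝ) - 2) * ((n : ℝ) - 10)) := by
      have : (n : ℝ) - 2 ≠ 0 := by linarith
      have : (n : ℝ) - 10 ≠ 0 := by linarith
      field_simp
    rw [this, pc]
    apply div_lt_div_of_pos_right _ hden
    nlinarith
  have h4 : 0 < 4 / ((n : ℝ) - 2) := div_pos (by norm_num) (by linarith)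
  have hp1 : 0 < p - 1 := by linarith
  refine ⟨by linarith, div_pos (by norm_num) hp1, ?_⟩
  unfold nuExp
  have h5 : 4 / ((n : ℝ) - 2) < p - 1 := by linarith
  rw [div_lt_iff₀ (by linarith)] at h5
  rw [← mul_div_assoc, div_lt_iff₀ hp1]
  linarith

lemma aux_L {n : ℕ} (hn : 10 < n) {p : ℝ} (hp : pc n < p) :
    0 < Lconst n p ∧ Lconst n p ^ (p - 1) = nuExp p * ((n : ℝ) - 2 - nuExp p) ∧
      p * Lconst n p ^ (p - 1) = (nuExp p + 2) * ((n : ℝ) - 2 - nuExp p) := by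
  obtain ⟨h1, h2, h3⟩ := aux_params hn hp
  have hpos : 0 < nuExp p * ((n : ℝ) - 2 - nuExp p) := mul_pos h2 (by linarith)
  have hp1 : p - 1 ≠ 0 := by linarith
  have hL : Lconst n p ^ (p - 1) = nuExp p * ((n : ℝ) - 2 - nuExp p) := by
    unfold Lconst
    rw [← Real.rpow_mul hpos.le, one_div, inv_mul_cancel₀ hp1, Real.rpow_one]
  refine ⟨Real.rpow_pos_of_pos hpos _, hL, ?_⟩
  rw [hL, ← mul_assoc]
  congr 1
  unfold nuExp
  field_simp
  ring

lemma aux_gamma {n : ℕ} (hn : 10 < n) {p γ : ℝ} (hp : pc n < p)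
    (hγ : γ ∈ Set.Ioo (nuExp p + lam1 n p) (((n : ℝ) - 2) / 2)) :
    0 < lam1 n p ∧ nuExp p < γ ∧ 0 < kappaOf n p γ ∧
      (kappaOf n p γ + 1) * (p * Lconst n p ^ (p - 1)) = γ * ((n : ℝ) - 2 - γ) := by
  obtain ⟨h1, h2, h3⟩ := aux_params hn hp
  obtain ⟨l1, l2, l3⟩ := aux_L hn hp
  obtain ⟨g1, g2⟩ := hγ
  have hpL : 0 < p * Lconst n p ^ (p - 1) := by
    rw [l3]; exact mul_pos (by linarith) (by linarith)
  set D := ((n : ℝ) - 2 - 2 * nuExp p) ^ 2 - 8 * ((n : ℝ) - 2 - nuExp p) with hD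
  have hl : lam1 n p = (((n : ℝ) - 2 - 2 * nuExp p) - Real.sqrt D) / 2 := rfl
  have hlpos : 0 < lam1 n p := by
    rw [hl]
    have : Real.sqrt D < (n : ℝ) - 2 - 2 * nuExp p := by
      rw [Real.sqrt_lt' (by linarith)]
      linarith
    linarith
  refine ⟨hlpos, by linarith, ?_, ?_⟩
  · rw [kappaOf, sub_pos, lt_div_iff₀ hpL, l3]
    have hs : ((n : ℝ) - 2) / 2 - γ < Real.sqrt D / 2 := by rw [hl] at g1; linarith
    have hsp : 0 < Real.sqrt D := by linarith
    have hDp : 0 < D := Real.sqrt_pos.mp hsp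
    have hsq := Real.sq_sqrt hDp.le
    have : (((n : ℝ) - 2) / 2 - γ) ^ 2 < (Real.sqrt D / 2) ^ 2 :=
      pow_lt_pow_left₀ hs (by linarith) (by norm_num)
    nlinarith
  · rw [kappaOf]
    have := hpL.ne'
    rw [sub_add_cancel, div_mul_cancel₀ _ this]

/-! steady state -/

lemma phi_pow_upper {n : ℕ} {p α a : ℝ} {φ : ℝ → ℝ} (hp1 : 1 < p) (hL : 0 < Lconst n p)
    (hφ : IsSteadyStateA n p α φ a) {r : ℝ} (hr : 0 < r) :
    φ r ^ (p - 1) * r ^ 2 ≤ Lconst n p ^ (p - 1) := by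
  have h := hφ.upper r hr
  have h1 : φ r ^ (p - 1) ≤ (Lconst n p * r ^ (-nuExp p)) ^ (p - 1) :=
    Real.rpow_le_rpow (hφ.pos r hr.le).le h (by linarith)
  rw [Real.mul_rpow hL.le (Real.rpow_nonneg hr.le _), ← Real.rpow_mul hr.le] at h1
  have h2 : -nuExp p * (p - 1) = -2 := by
    unfold nuExp
    have : p - 1 ≠ 0 := by linarith
    field_simp
  rw [h2] at h1
  have h3 : r ^ (-2 : ℝ) * r ^ 2 = 1 := by
    rw [← Real.rpow_natCast, ← Real.rpow_add hr]; norm_num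
  calc φ r ^ (p - 1) * r ^ 2 ≤ (Lconst n p ^ (p - 1) * r ^ (-2 : ℝ)) * r ^ 2 := by gcongr
    _ = _ := by rw [mul_assoc, h3, mul_one]

lemma phi_lower {n : ℕ} {p α a : ℝ} {φ : ℝ → ℝ} (hL : 0 < Lconst n p) (hl : 0 < lam1 n p)
    (hφ : IsSteadyStateA n p α φ a) :
    ∀ᶠ r in atTop, Lconst n p / 2 * r ^ (-nuExp p) ≤ φ r := by
  have h1 := hφ.expansion.bound (c := 1) one_pos
  have h2 : Tendsto (fun r : ℝ => (a + 1) * r ^ (-lam1 n p)) atTop (𝓝 0) := by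
    simpa using (tendsto_rpow_neg_atTop hl).const_mul (a + 1)
  have h3 := h2.eventually_le_const (half_pos hL)
  filter_upwards [h1, h3, eventually_gt_atTop 0] with r h1 h3 hr
  have e : r ^ (-nuExp p - lam1 n p) = r ^ (-nuExp p) * r ^ (-lam1 n p) := by
    rw [← Real.rpow_add hr]; ring_nf
  have hp1 := Real.rpow_pos_of_pos hr (-nuExp p)
  have hp2 := Real.rpow_pos_of_pos hr (-lam1 n p)
  rw [e, Real.norm_eq_abs, Real.norm_eq_abs, abs_of_pos (mul_pos hp1 hp2), one_mul] at h1
  have h4 := (abs_le.mp h1).1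
  nlinarith

lemma phi_pow_lower {n : ℕ} {p : ℝ} {φ : ℝ → ℝ} (hp1 : 1 < p) (hL : 0 < Lconst n p)
    {r : ℝ} (hr : 0 < r) (h : Lconst n p / 2 * r ^ (-nuExp p) ≤ φ r) :
    (Lconst n p / 2) ^ (p - 1) ≤ φ r ^ (p - 1) * r ^ 2 := by
  have hpos : 0 < Lconst n p / 2 * r ^ (-nuExp p) :=
    mul_pos (half_pos hL) (Real.rpow_pos_of_pos hr _)
  have h1 : (Lconst n p / 2 * r ^ (-nuExp p)) ^ (p - 1) ≤ φ r ^ (p - 1) :=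
    Real.rpow_le_rpow hpos.le h (by linarith)
  rw [Real.mul_rpow (half_pos hL).le (Real.rpow_nonneg hr.le _), ← Real.rpow_mul hr.le] at h1
  have h2 : -nuExp p * (p - 1) = -2 := by
    unfold nuExp
    have : p - 1 ≠ 0 := by linarith
    field_simp
  rw [h2] at h1
  have h3 : r ^ (-2 : ℝ) * r ^ 2 = 1 := by
    rw [← Real.rpow_natCast, ← Real.rpow_add hr]; norm_num
  calc (Lconst n p / 2) ^ (p - 1) = ((Lconst n p / 2) ^ (p - 1) * r ^ (-2 : ℝ)) * r ^ 2 := by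
        rw [mul_assoc, h3, mul_one]
    _ ≤ _ := by gcongr

lemma c2_hasDeriv {g : ℝ → ℝ} (hg : ContDiffOn ℝ 2 g (Set.Ioi 0)) {r : ℝ} (hr : 0 < r) :
    HasDerivAt g (deriv g r) r ∧ HasDerivAt (deriv g) (deriv (deriv g) r) r := by
  have h : ContDiffAt ℝ 2 g r := (hg r hr).contDiffAt (Ioi_mem_nhds hr)
  refine ⟨(h.differentiableAt (by norm_num)).hasDerivAt, ?_⟩
  have h2 : ContDiffOn ℝ (1 + 1) g (Set.Ioi 0) := by simpa [one_add_one_eq_two] using hg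
  have h' := ((contDiffOn_succ_iff_deriv_of_isOpen isOpen_Ioi).mp h2).2.2
  exact ((h'.contDiffAt (Ioi_mem_nhds hr)).differentiableAt (by norm_num)).hasDerivAt

lemma phi_deriv_nonpos {n : ℕ} {p α a : ℝ} {φ : ℝ → ℝ} (hφ : IsSteadyStateA n p α φ a)
    {r : ℝ} (hr : 0 < r) : deriv φ r ≤ 0 := by
  have h : AntitoneOn φ (Set.Ici 0) := hφ.anti.antitoneOn
  have h2 := h.derivWithin_nonpos (x := r)
  rwa [derivWithin_of_mem_nhds (Ici_mem_nhds hr)] at h2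

lemma phi_deriv_lower {n : ℕ} (hn : 10 < n) {p α a : ℝ} {φ : ℝ → ℝ} (hp1 : 1 < p)
    (hα : 0 < α) (hφ : IsSteadyStateA n p α φ a) {r : ℝ} (hr : 0 < r) :
    -(α ^ p * r) ≤ deriv φ r := by
  by_contra hcon
  push Not at hcon
  have hn' : (11 : ℝ) ≤ n := by exact_mod_cast hn
  have hle : ∀ s > 0, φ s ≤ α := fun s hs => by
    rw [← hφ.val0]; exact hφ.anti.antitoneOn (by simp) (Set.mem_Ici.mpr hs.le) hs.le
  -- g s = s^(n-1) φ' + α^p s^n is monotone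
  set g : ℝ → ℝ := fun s => s ^ (n - 1) * deriv φ s + α ^ p * s ^ n with hg
  have hgd : ∀ s > 0, HasDerivAt g (((n - 1 : ℕ) : ℝ) * s ^ (n - 1 - 1) * deriv φ s +
      s ^ (n - 1) * deriv (deriv φ) s + α ^ p * ((n : ℝ) * s ^ (n - 1))) s := by
    intro s hs
    exact ((hasDerivAt_pow (n - 1) s).mul (c2_hasDeriv hφ.smooth hs).2).add
      ((hasDerivAt_pow n s).const_mul _)
  have hmono : MonotoneOn g (Set.Ioi 0) := by
    apply monotoneOn_of_deriv_nonneg (convex_Ioi 0)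
    · exact fun s hs => (hgd s hs).continuousAt.continuousWithinAt
    · intro s hs; rw [interior_Ioi] at hs
      exact (hgd s hs).differentiableAt.differentiableWithinAt
    · intro s hs; rw [interior_Ioi] at hs
      have hs : 0 < s := hs
      rw [(hgd s hs).deriv]
      obtain ⟨m, rfl⟩ : ∃ m, n = m + 2 := ⟨n - 2, by omega⟩
      have hode := hφ.ode s hs
      have h1 : (m + 2 - 1 : ℕ) = m + 1 := by omega
      have h2 : (m + 1 - 1 : ℕ) = m := by omega
      rw [h1, h2]
      push_cast at hode ⊢
      have h3 : deriv (deriv φ) s = -(((m : ℝ) + 2 - 1) / s * deriv φ s) - φ s ^ p := by linarith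
      have h4 : φ s ^ p ≤ α ^ p := Real.rpow_le_rpow (hφ.pos s hs.le).le (hle s hs) (by linarith)
      have h5 : ((m : ℝ) + 1) * s ^ m * deriv φ s + s ^ (m + 1) * deriv (deriv φ) s +
          α ^ p * (((m : ℝ) + 2) * s ^ (m + 1)) =
          s ^ (m + 1) * (α ^ p * ((m : ℝ) + 2) - φ s ^ p) := by
        rw [h3]; field_simp; ring
      rw [h5]
      apply mul_nonneg (by positivity)
      have : 0 < α ^ p := by positivity
      have : (0 : ℝ) ≤ m := by positivity
      nlinarith
  have hgr : g r < 0 := by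
    obtain ⟨m, rfl⟩ : ∃ m, n = m + 1 := ⟨n - 1, by omega⟩
    simp only [hg, Nat.add_sub_cancel]
    have : r ^ m * deriv φ r + α ^ p * r ^ (m + 1) = r ^ m * (deriv φ r + α ^ p * r) := by ring
    rw [this]
    exact mul_neg_of_pos_of_neg (by positivity) (by linarith)
  -- choose constant
  set d := -g r * (1 / r ^ (n - 2)) with hd
  have hdpos : 0 < d := mul_pos (by linarith) (by positivity)
  have hder : ∀ s, 0 < s → s ≤ r → deriv φ s ≤ -d / s := by
    intro s hs hsr
    have h1 := hmono (Set.mem_Ioi.mpr hs) (Set.mem_Ioi.mpr hr) hsr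
    have h2 : s ^ (n - 1) * deriv φ s ≤ g r := by
      have : 0 ≤ α ^ p * s ^ n := by positivity
      simp only [hg] at h1 ⊢; linarith
    obtain ⟨m, rfl⟩ : ∃ m, n = m + 2 := ⟨n - 2, by omega⟩
    have e1 : (m + 2 - 1 : ℕ) = m + 1 := by omega
    have e2 : (m + 2 - 2 : ℕ) = m := by omega
    rw [e1] at h2
    rw [e2] at hd
    have hsm : s ^ m ≤ r ^ m := pow_le_pow_left₀ hs.le hsr m
    have h3 : g r = -d * r ^ m := by rw [hd]; field_simp
    rw [h3] at h2
    rw [le_div_iff₀ hs]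
    have h4 : s ^ m * (deriv φ s * s) ≤ s ^ m * (-d) := by
      calc s ^ m * (deriv φ s * s) = s ^ (m + 1) * deriv φ s := by ring
        _ ≤ -d * r ^ m := h2
        _ ≤ s ^ m * (-d) := by nlinarith
    exact le_of_mul_le_mul_left h4 (by positivity)
  have hanti : AntitoneOn (fun s => φ s + d * Real.log s) (Set.Ioc 0 r) := by
    have hD : ∀ s > 0, HasDerivAt (fun s => φ s + d * Real.log s) (deriv φ s + d * s⁻¹) s :=
      fun s hs => (c2_hasDeriv hφ.smooth hs).1.add ((Real.hasDerivAt_log hs.ne').const_mul d)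
    apply antitoneOn_of_deriv_nonpos (convex_Ioc 0 r)
    · exact fun s hs => (hD s hs.1).continuousAt.continuousWithinAt
    · intro s hs; rw [interior_Ioc] at hs
      exact (hD s hs.1).differentiableAt.differentiableWithinAt
    · intro s hs; rw [interior_Ioc] at hs
      rw [(hD s hs.1).deriv]
      have := hder s hs.1 hs.2.le
      rw [neg_div, div_eq_mul_inv] at this
      linarith
  have hlim : Tendsto (fun s => d * Real.log s) (𝓝[>] 0) atBot :=
    Real.tendsto_log_nhdsGT_zero.const_mul_atBot hdpos
  have hev := hlim.eventually_lt_atBot (φ r + d * Real.log r - α)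
  obtain ⟨s, hs1, hs2, hs3⟩ := (hev.and (Ioc_mem_nhdsGT hr)).exists
  have h1 := hanti ⟨hs2, hs3⟩ ⟨hr, le_rfl⟩ hs3
  have h2 := hle s hs2
  simp only at h1
  linarith

lemma phi_slope0 {n : ℕ} (hn : 10 < n) {p α a : ℝ} {φ : ℝ → ℝ} (hp1 : 1 < p)
    (hα : 0 < α) (hφ : IsSteadyStateA n p α φ a) :
    HasDerivWithinAt φ 0 (Set.Ici 0) 0 := by
  by_cases hd : DifferentiableWithinAt ℝ φ (Set.Ici 0) 0
  · have := hd.hasDerivWithinAt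
    rwa [hφ.deriv0] at this
  · exfalso
    apply hd
    have : HasDerivWithinAt φ 0 (Set.Ici 0) 0 := by
      apply hasDerivWithinAt_Ici_of_tendsto_deriv (s := Set.Ioi 0)
      · exact fun s hs => (c2_hasDeriv hφ.smooth hs).1.differentiableAt.differentiableWithinAt
      · exact (hφ.cont 0 (by simp)).mono Set.Ioi_subset_Ici_self
      · exact self_mem_nhdsWithin
      · have h1 : Tendsto (fun s : ℝ => -(α ^ p * s)) (𝓝[>] 0) (𝓝 0) := by
          have : Continuous (fun s : ℝ => -(α ^ p * s)) := by fun_prop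
          have := (this.tendsto 0).mono_left (nhdsWithin_le_nhds (s := Set.Ioi 0))
          simpa using this
        refine tendsto_of_tendsto_of_tendsto_of_le_of_le' h1 tendsto_const_nhds ?_ ?_
        · filter_upwards [self_mem_nhdsWithin] with s hs
          exact phi_deriv_lower hn hp1 hα hφ hs
        · filter_upwards [self_mem_nhdsWithin] with s hs
          exact phi_deriv_nonpos hφ hs
    exact this.differentiableWithinAt

/-! touching lemmas -/

lemma second_deriv_min {g g' : ℝ → ℝ} {g2 r0 : ℝ} (hmin : IsLocalMin g r0)
    (h1 : ∀ᶠ r in 𝓝 r0, HasDerivAt g (g' r) r) (h2 : HasDerivAt g' g2 r0) :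
    g' r0 = 0 ∧ 0 ≤ g2 := by
  have hz : g' r0 = 0 := hmin.hasDerivAt_eq_zero h1.self_of_nhds
  refine ⟨hz, ?_⟩
  by_contra hneg
  push Not at hneg
  have hd : deriv g =ᶠ[𝓝 r0] g' := h1.mono fun r hr => hr.deriv
  have hdd : deriv (deriv g) r0 = g2 := by rw [hd.deriv_eq, h2.deriv]
  have hmax : IsLocalMax g r0 := isLocalMax_of_deriv_deriv_neg (by rw [hdd]; exact hneg)
    (by rw [h1.self_of_nhds.deriv, hz]) h1.self_of_nhds.continuousAt
  have hconst : g =ᶠ[𝓝 r0] fun _ => g r0 := by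
    filter_upwards [hmin, hmax] with r a b using le_antisymm b a
  have : deriv (deriv g) r0 = 0 := by
    have h3 : deriv g =ᶠ[𝓝 r0] deriv (fun _ => g r0) := hconst.deriv
    rw [h3.deriv_eq]; simp
  rw [hdd] at this
  linarith

lemma left_deriv_le {u h : ℝ → ℝ} {du dh t0 : ℝ} (hu : HasDerivAt u du t0)
    (hh : HasDerivAt h dh t0) (heq : u t0 = h t0) (hle : ∀ᶠ t in 𝓝[<] t0, h t ≤ u t) :
    du ≤ dh := by
  have hd : HasDerivWithinAt (fun t => u t - h t) (du - dh) (Set.Iio t0) t0 :=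
    (hu.sub hh).hasDerivWithinAt
  rw [hasDerivWithinAt_iff_tendsto_slope] at hd
  have hs : Set.Iio t0 \ {t0} = Set.Iio t0 := by
    ext x; simp
  rw [hs] at hd
  have : du - dh ≤ 0 := by
    refine le_of_tendsto hd ?_
    filter_upwards [hle, self_mem_nhdsWithin] with t ht ht0
    have ht0 : t < t0 := ht0
    rw [slope_def_field]
    apply div_nonpos_of_nonneg_of_nonpos
    · rw [heq]; linarith
    · linarith
  linarith

lemma first_touch {g : ℝ × ℝ → ℝ} {R T : ℝ}
    (hg : ContinuousOn g (Set.Icc 0 R ×ˢ Set.Icc 0 T))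
    (hinit : ∀ r ∈ Set.Icc 0 R, 0 < g (r, 0)) (hout : ∀ t ∈ Set.Icc 0 T, 0 < g (R, t))
    (hbad : ∃ r ∈ Set.Icc 0 R, ∃ t ∈ Set.Icc 0 T, g (r, t) ≤ 0) :
    ∃ r0 t0, 0 ≤ r0 ∧ r0 < R ∧ 0 < t0 ∧ t0 ≤ T ∧ g (r0, t0) = 0 ∧
      ∀ r ∈ Set.Icc 0 R, ∀ t ∈ Set.Icc 0 t0, 0 ≤ g (r, t) := by
  set K := Set.Icc (0:ℝ) R ×ˢ Set.Icc (0:ℝ) T with hK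
  have hKc : IsCompact K := isCompact_Icc.prod isCompact_Icc
  set B := K ∩ g ⁻¹' Set.Iic 0 with hB
  have hBc : IsCompact B :=
    hKc.of_isClosed_subset (hg.preimage_isClosed_of_isClosed hKc.isClosed isClosed_Iic)
      Set.inter_subset_left
  obtain ⟨r, hr, t, ht, hrt⟩ := hbad
  obtain ⟨⟨r0, t0⟩, ⟨⟨hr0, ht0⟩, hg0⟩, hmin⟩ :=
    hBc.exists_isMinOn ⟨(r, t), ⟨hr, ht⟩, hrt⟩ continuous_snd.continuousOn
  have hr0 : r0 ∈ Set.Icc 0 R := hr0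
  have ht0 : t0 ∈ Set.Icc 0 T := ht0
  have hg0 : g (r0, t0) ≤ 0 := hg0
  have hbefore : ∀ r ∈ Set.Icc 0 R, ∀ t ∈ Set.Icc 0 T, t < t0 → 0 < g (r, t) := by
    intro r hr t ht htt
    by_contra hc
    push Not at hc
    have := hmin (a := (r, t)) ⟨⟨hr, ht⟩, hc⟩
    simp at this
    linarith
  have ht0pos : 0 < t0 := by
    rcases ht0.1.eq_or_lt with h | h
    · have := hinit r0 hr0; rw [h] at this; linarith
    · exact h
  have hat : ∀ r ∈ Set.Icc 0 R, 0 ≤ g (r, t0) := by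
    intro r hr
    have hc : ContinuousWithinAt (fun t => g (r, t)) (Set.Icc 0 T) t0 :=
      (hg (r, t0) ⟨hr, ht0⟩).comp (f := fun t => (r, t)) (by fun_prop)
        (fun t ht => ⟨hr, ht⟩)
    have hc2 : Tendsto (fun t => g (r, t)) (𝓝[Set.Ioo 0 t0] t0) (𝓝 (g (r, t0))) :=
      hc.mono (fun t ht => ⟨ht.1.le, ht.2.le.trans ht0.2⟩)
    have : (𝓝[Set.Ioo 0 t0] t0).NeBot := by
      rw [nhdsWithin_Ioo_eq_nhdsLT ht0pos]; infer_instance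
    refine ge_of_tendsto hc2 ?_
    filter_upwards [self_mem_nhdsWithin] with t ht
    exact (hbefore r hr t ⟨ht.1.le, ht.2.le.trans ht0.2⟩ ht.2).le
  refine ⟨r0, t0, hr0.1, ?_, ht0pos, ht0.2, le_antisymm hg0 (hat r0 hr0), ?_⟩
  · rcases hr0.2.eq_or_lt with h | h
    · have := hout t0 ht0; rw [← h] at this; linarith
    · exact h
  · intro r hr t ht
    rcases ht.2.eq_or_lt with h | h
    · rw [h]; exact hat r hr
    · exact (hbefore r hr t ⟨ht.1, ht.2.trans ht0.2⟩ h).le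

lemma no_touch_zero {g : ℝ → ℝ} {d R : ℝ} (hR : 0 < R) (hd : d < 0)
    (h : HasDerivWithinAt g d (Set.Ici 0) 0) (h0 : g 0 = 0)
    (hnn : ∀ r ∈ Set.Icc 0 R, 0 ≤ g r) : False := by
  have h' := h.mono (Set.Ioi_subset_Ici_self)
  rw [hasDerivWithinAt_iff_tendsto_slope] at h'
  have hs : Set.Ioi (0:ℝ) \ {0} = Set.Ioi 0 := by
    ext x; simp
  rw [hs] at h'
  have : 0 ≤ d := by
    refine ge_of_tendsto h' ?_
    filter_upwards [Ioc_mem_nhdsGT hR] with t ht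
    rw [slope_def_field, h0]
    apply div_nonneg
    · have := hnn t ⟨ht.1.le, ht.2⟩; linarith
    · have := ht.1; linarith
  linarith

lemma touch_lower {n : ℕ} {p : ℝ} {v : ℝ → ℝ → ℝ} {v₀ : ℝ → ℝ} (hp1 : 1 < p)
    (hv : IsRadialSol n p v v₀) {r0 t0 : ℝ} (hr0 : 0 < r0) (ht0 : 0 < t0)
    {wS wS' wT : ℝ → ℝ} {w2 wt : ℝ}
    (hS1 : ∀ᶠ r in 𝓝 r0, HasDerivAt wS (wS' r) r) (hS2 : HasDerivAt wS' w2 r0)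
    (hSle : ∀ᶠ r in 𝓝 r0, wS r ≤ v r t0) (hSeq : wS r0 = v r0 t0)
    (hT : HasDerivAt wT wt t0) (hTle : ∀ᶠ t in 𝓝[<] t0, wT t ≤ v r0 t)
    (hTeq : wT t0 = v r0 t0) :
    w2 + ((n : ℝ) - 1) / r0 * wS' r0 + v r0 t0 ^ p ≤ p * v r0 t0 ^ (p - 1) * wt := by
  have hsm : ContDiffOn ℝ 2 (fun r => v r t0) (Set.Ioi 0) :=
    (hv.smooth_r t0 ht0).mono Set.Ioi_subset_Ici_self
  have hev : ∀ᶠ r in 𝓝 r0, 0 < r := Ioi_mem_nhds hr0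
  have hmin : IsLocalMin (fun r => v r t0 - wS r) r0 := by
    filter_upwards [hSle] with r hr
    rw [hSeq]; linarith
  obtain ⟨e1, e2⟩ := second_deriv_min (g' := fun r => deriv (fun ρ => v ρ t0) r - wS' r) hmin
    (by filter_upwards [hev, hS1] with r hr h using (c2_hasDeriv hsm hr).1.sub h)
    ((c2_hasDeriv hsm hr0).2.sub hS2)
  have hpde := hv.pde r0 hr0 t0 ht0
  have hu : HasDerivAt (fun s => v r0 s ^ p) (deriv (fun s => v r0 s ^ p) t0) t0 := by
    have := (hv.smooth_t r0 hr0.le).contDiffAt (Ioi_mem_nhds ht0)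
    exact (this.differentiableAt (by norm_num)).hasDerivAt
  have htime : deriv (fun s => v r0 s ^ p) t0 ≤ p * v r0 t0 ^ (p - 1) * wt := by
    have hvn := hv.nonneg r0 hr0.le t0 ht0.le
    have hpos' : ∀ᶠ t in 𝓝[<] t0, 0 < t :=
      (eventually_gt_nhds ht0).filter_mono nhdsWithin_le_nhds
    rcases hvn.eq_or_lt with h | h
    · have h1 := left_deriv_le hu (hasDerivAt_const t0 (0:ℝ))
        (by rw [← h, Real.zero_rpow (by linarith)])
        (by
          filter_upwards [hpos'] with t ht
          exact Real.rpow_nonneg (hv.nonneg r0 hr0.le t ht.le) _)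
      rw [← h, Real.zero_rpow (by linarith)]
      linarith
    · have hw : HasDerivAt (fun t => wT t ^ p) (wt * p * wT t0 ^ (p - 1)) t0 :=
        hT.rpow_const (Or.inr hp1.le)
      have h1 := left_deriv_le hu hw (by rw [hTeq]) (by
        have hwp : ∀ᶠ t in 𝓝[<] t0, 0 < wT t :=
          (hT.continuousAt.tendsto.eventually_const_lt (by simpa [hTeq] using h)).filter_mono
            nhdsWithin_le_nhds
        filter_upwards [hwp, hTle] with t a b
        exact Real.rpow_le_rpow a.le b (by linarith))
      rw [hTeq] at h1
      linarith
  have e1 : deriv (fun ρ => v ρ t0) r0 = wS' r0 := by linarith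
  rw [e1] at hpde
  linarith

lemma touch_upper {n : ℕ} {p : ℝ} {v : ℝ → ℝ → ℝ} {v₀ : ℝ → ℝ} (hp1 : 1 < p)
    (hv : IsRadialSol n p v v₀) {r0 t0 : ℝ} (hr0 : 0 < r0) (ht0 : 0 < t0)
    {wS wS' wT : ℝ → ℝ} {w2 wt : ℝ}
    (hS1 : ∀ᶠ r in 𝓝 r0, HasDerivAt wS (wS' r) r) (hS2 : HasDerivAt wS' w2 r0)
    (hSle : ∀ᶠ r in 𝓝 r0, v r t0 ≤ wS r) (hSeq : wS r0 = v r0 t0)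
    (hT : HasDerivAt wT wt t0) (hTle : ∀ᶠ t in 𝓝[<] t0, v r0 t ≤ wT t)
    (hTeq : wT t0 = v r0 t0) :
    p * v r0 t0 ^ (p - 1) * wt ≤ w2 + ((n : ℝ) - 1) / r0 * wS' r0 + v r0 t0 ^ p := by
  have hsm : ContDiffOn ℝ 2 (fun r => v r t0) (Set.Ioi 0) :=
    (hv.smooth_r t0 ht0).mono Set.Ioi_subset_Ici_self
  have hev : ∀ᶠ r in 𝓝 r0, 0 < r := Ioi_mem_nhds hr0
  have hmin : IsLocalMin (fun r => wS r - v r t0) r0 := by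
    filter_upwards [hSle] with r hr
    rw [hSeq]; linarith
  obtain ⟨e1, e2⟩ := second_deriv_min (g' := fun r => wS' r - deriv (fun ρ => v ρ t0) r) hmin
    (by filter_upwards [hev, hS1] with r hr h using h.sub (c2_hasDeriv hsm hr).1)
    (hS2.sub (c2_hasDeriv hsm hr0).2)
  have hpde := hv.pde r0 hr0 t0 ht0
  have hu : HasDerivAt (fun s => v r0 s ^ p) (deriv (fun s => v r0 s ^ p) t0) t0 := by
    have := (hv.smooth_t r0 hr0.le).contDiffAt (Ioi_mem_nhds ht0)
    exact (this.differentiableAt (by norm_num)).hasDerivAt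
  have htime : p * v r0 t0 ^ (p - 1) * wt ≤ deriv (fun s => v r0 s ^ p) t0 := by
    have hpos' : ∀ᶠ t in 𝓝[<] t0, 0 < t :=
      (eventually_gt_nhds ht0).filter_mono nhdsWithin_le_nhds
    have hw : HasDerivAt (fun t => wT t ^ p) (wt * p * wT t0 ^ (p - 1)) t0 :=
      hT.rpow_const (Or.inr hp1.le)
    have h1 := left_deriv_le hw hu (by rw [hTeq]) (by
      filter_upwards [hpos', hTle] with t a b
      exact Real.rpow_le_rpow (hv.nonneg r0 hr0.le t a.le) b (by linarith))
    rw [hTeq] at h1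
    linarith
  have e1 : deriv (fun ρ => v ρ t0) r0 = wS' r0 := by linarith
  rw [e1] at hpde
  linarith

lemma phi_weight {n : ℕ} {p α a : ℝ} {φ : ℝ → ℝ} (hp1 : 1 < p) (hL : 0 < Lconst n p)
    (hl : 0 < lam1 n p) (hφ : IsSteadyStateA n p α φ a) :
    ∃ c > 0, ∀ r > 0, c ≤ φ r ^ (p - 1) * (1 + r ^ 2) := by
  obtain ⟨R, hR⟩ := eventually_atTop.mp ((phi_lower hL hl hφ).and (eventually_gt_atTop 0))
  have hRp : 0 < R := (hR R le_rfl).2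
  have hφR : 0 < φ R ^ (p - 1) := Real.rpow_pos_of_pos (hφ.pos R hRp.le) _
  have hLp : 0 < (Lconst n p / 2) ^ (p - 1) := Real.rpow_pos_of_pos (half_pos hL) _
  refine ⟨min (φ R ^ (p - 1)) ((Lconst n p / 2) ^ (p - 1)), lt_min hφR hLp, ?_⟩
  intro r hr
  have hpos : 0 < φ r ^ (p - 1) := Real.rpow_pos_of_pos (hφ.pos r hr.le) _
  rcases le_total R r with h | h
  · refine (min_le_right _ _).trans ((phi_pow_lower hp1 hL hr (hR r h).1).trans ?_)
    nlinarith
  · refine (min_le_left _ _).trans ?_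
    have h1 : φ R ≤ φ r := hφ.anti.antitoneOn hr.le hRp.le h
    have h2 : φ R ^ (p - 1) ≤ φ r ^ (p - 1) :=
      Real.rpow_le_rpow (hφ.pos R hRp.le).le h1 (by linarith)
    nlinarith [mul_nonneg hpos.le (sq_nonneg r)]

/-- tangent inequality: `x^p ≥ y^p + p y^{p-1} (x-y)`. -/
lemma rpow_tangent {p x y : ℝ} (hp1 : 1 < p) (hx : 0 ≤ x) (hy : 0 < y) :
    y ^ p + p * y ^ (p - 1) * (x - y) ≤ x ^ p := by
  have h := one_add_mul_self_le_rpow_one_add (s := x / y - 1) (p := p)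
    (by have : 0 ≤ x / y := by positivity
        linarith) hp1.le
  have e : 1 + (x / y - 1) = x / y := by ring
  rw [e, Real.div_rpow hx hy.le, le_div_iff₀ (Real.rpow_pos_of_pos hy p)] at h
  refine le_trans (le_of_eq ?_) h
  have e2 : y ^ p = y ^ (p - 1) * y := by
    rw [← Real.rpow_add_one hy.ne']; ring_nf
  rw [e2]; field_simp

lemma v_cont_slice {n : ℕ} {p : ℝ} {v : ℝ → ℝ → ℝ} {v₀ : ℝ → ℝ}
    (hv : IsRadialSol n p v v₀) (R T : ℝ) :
    ContinuousOn (fun q : ℝ × ℝ => v q.1 q.2) (Set.Icc 0 R ×ˢ Set.Icc 0 T) :=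
  hv.cont.mono (Set.prod_mono Set.Icc_subset_Ici_self Set.Icc_subset_Ici_self)

lemma v_slope0 {n : ℕ} {p : ℝ} {v : ℝ → ℝ → ℝ} {v₀ : ℝ → ℝ}
    (hv : IsRadialSol n p v v₀) {t : ℝ} (ht : 0 < t) :
    HasDerivWithinAt (fun r => v r t) 0 (Set.Ici 0) 0 := by
  have h := ((hv.smooth_r t ht).differentiableOn (by norm_num) 0 (by simp)).hasDerivWithinAt
  rwa [hv.slope0 t ht] at h

set_option maxHeartbeats 1000000 in
lemma upper_bound {n : ℕ} (hn : 10 < n) {p α a : ℝ} (hp1 : 1 < p) (hα : 0 < α)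
    (hL : 0 < Lconst n p) (hl : 0 < lam1 n p) {φ : ℝ → ℝ} (hφ : IsSteadyStateA n p α φ a)
    {v₀ : ℝ → ℝ} (hup : ∀ r ≥ (0 : ℝ), v₀ r ≤ φ r) {v : ℝ → ℝ → ℝ}
    (hv : IsRadialSol n p v v₀) : ∀ r ≥ (0 : ℝ), ∀ t ≥ (0 : ℝ), v r t ≤ φ r := by
  obtain ⟨c, hc, hcw⟩ := phi_weight hp1 hL hl hφ
  have hn' : (11 : ℝ) ≤ n := by exact_mod_cast hn
  set K : ℝ := 2 + (2 * n + 1) / (p * c) with hKdef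
  have hpc : 0 < p * c := mul_pos (by linarith) hc
  set Z : ℝ → ℝ := fun r => Real.exp (-r) + 1 + r ^ 2 with hZ
  set Z' : ℝ → ℝ := fun r => -Real.exp (-r) + 2 * r with hZ'
  have hZd : ∀ r, HasDerivAt Z (Z' r) r := by
    intro r
    have h1 : HasDerivAt (fun r : ℝ => Real.exp (-r)) (Real.exp (-r) * (-1)) r :=
      (hasDerivAt_neg r).exp
    have h2 := (h1.add_const 1).add (hasDerivAt_pow 2 r)
    refine h2.congr_deriv ?_
    simp [hZ']
  have hZd2 : ∀ r, HasDerivAt Z' (Real.exp (-r) + 2) r := by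
    intro r
    have h1 : HasDerivAt (fun r : ℝ => Real.exp (-r)) (Real.exp (-r) * (-1)) r :=
      (hasDerivAt_neg r).exp
    refine (h1.neg.add ((hasDerivAt_id r).const_mul 2)).congr_deriv ?_
    ring
  have hZc : Continuous Z := by simp only [hZ]; fun_prop
  have hZpos : ∀ r, 1 + r ^ 2 ≤ Z r := fun r => by
    have := Real.exp_pos (-r); simp only [hZ]; linarith
  have key : ∀ T > 0, ∀ δ > 0, ∀ r ≥ 0, v r T ≤ φ r + δ * Real.exp (K * T) * Z r := by
    intro T hT δ hδ r hr
    obtain ⟨M, hM⟩ := hv.bdd T hT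
    set R := max (r + 1) (Real.sqrt ((|M| + 1) / δ)) with hRdef
    have hrR : r < R := lt_of_lt_of_le (by linarith) (le_max_left _ _)
    have hRpos : 0 < R := by linarith
    have hRM : |M| + 1 ≤ δ * R ^ 2 := by
      have h1 : Real.sqrt ((|M| + 1) / δ) ≤ R := le_max_right _ _
      have h2 := pow_le_pow_left₀ (Real.sqrt_nonneg _) h1 2
      rw [Real.sq_sqrt (by positivity), div_le_iff₀ hδ] at h2
      linarith
    by_contra hcon
    push Not at hcon
    have hKpos : 0 < K := by
      have : 0 < (2 * (n : ℝ) + 1) / (p * c) := div_pos (by linarith) hpc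
      linarith
    set g : ℝ × ℝ → ℝ := fun q => φ q.1 + δ * Real.exp (K * q.2) * Z q.1 - v q.1 q.2 with hg
    obtain ⟨r0, t0, hr0, hr0R, ht0, ht0T, hg0, hgnn⟩ := first_touch (g := g) (R := R) (T := T)
      (by
        apply ContinuousOn.sub _ (v_cont_slice hv R T)
        apply ContinuousOn.add
        · exact (hφ.cont.mono Set.Icc_subset_Ici_self).comp continuousOn_fst (fun q hq => hq.1)
        · apply Continuous.continuousOn; fun_prop)
      (by
        intro s hs
        have h1 := hup s hs.1
        have h2 := hv.init s hs.1
        have h3 := hZpos s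
        simp only [hg, mul_zero, Real.exp_zero, mul_one]
        have : 0 < δ * Z s := mul_pos hδ (by nlinarith [sq_nonneg s])
        linarith)
      (by
        intro t ht
        have h1 := hM R hRpos.le t ht
        have h2 := hφ.pos R hRpos.le
        have h3 := hZpos R
        have h4 : 1 ≤ Real.exp (K * t) := Real.one_le_exp (mul_nonneg hKpos.le ht.1)
        have h5 : δ * R ^ 2 ≤ δ * Real.exp (K * t) * Z R := by
          have : δ * 1 * R ^ 2 ≤ δ * Real.exp (K * t) * Z R := by
            gcongr; linarith
          linarith
        have h6 := le_abs_self M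
        simp only [hg]
        linarith)
      ⟨r, ⟨hr, hrR.le⟩, T, ⟨hT.le, le_rfl⟩, by simp only [hg]; linarith⟩
    set B := δ * Real.exp (K * t0) with hB
    have hBpos : 0 < B := mul_pos hδ (Real.exp_pos _)
    rcases hr0.eq_or_lt with h0 | h0
    · subst h0
      have hd : HasDerivWithinAt (fun s => g (s, t0)) (0 + B * Z' 0 - 0) (Set.Ici 0) 0 :=
        ((phi_slope0 hn hp1 hα hφ).add ((hZd 0).hasDerivWithinAt.const_mul B)).sub
          (v_slope0 hv ht0)
      refine no_touch_zero hRpos ?_ hd hg0 (fun s hs => hgnn s hs t0 ⟨ht0.le, le_rfl⟩)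
      simp [hZ']; exact hBpos
    · have heq : φ r0 + B * Z r0 = v r0 t0 := by
        have : φ r0 + δ * Real.exp (K * t0) * Z r0 - v r0 t0 = 0 := hg0
        linarith
      have hineq := touch_upper hp1 hv h0 ht0 (wS := fun s => φ s + B * Z s)
        (wS' := fun s => deriv φ s + B * Z' s)
        (w2 := deriv (deriv φ) r0 + B * (Real.exp (-r0) + 2))
        (wT := fun t => φ r0 + δ * Real.exp (K * t) * Z r0)
        (wt := K * (B * Z r0))
        (by
          filter_upwards [Ioi_mem_nhds h0] with s hs
          exact (c2_hasDeriv hφ.smooth hs).1.add ((hZd s).const_mul B))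
        ((c2_hasDeriv hφ.smooth h0).2.add ((hZd2 r0).const_mul B))
        (by
          filter_upwards [Ioo_mem_nhds h0 hr0R] with s hs
          have := hgnn s ⟨hs.1.le, hs.2.le⟩ t0 ⟨ht0.le, le_rfl⟩
          simp only [hg] at this
          linarith)
        heq
        (by
          have h1 : HasDerivAt (fun t : ℝ => Real.exp (K * t)) (Real.exp (K * t0) * (K * 1)) t0 :=
            ((hasDerivAt_id t0).const_mul K).exp
          refine (((h1.const_mul δ).mul_const (Z r0)).const_add (φ r0)).congr_deriv ?_
          rw [hB]; ring)
        (by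
          filter_upwards [Ioo_mem_nhdsLT ht0] with t ht
          have := hgnn r0 ⟨hr0, hr0R.le⟩ t ⟨ht.1.le, ht.2.le⟩
          simp only [hg] at this
          linarith)
        heq
      have hφ0 := hφ.pos r0 hr0
      have hZ0 := hZpos r0
      have hE : 0 < B * Z r0 := mul_pos hBpos (by nlinarith [sq_nonneg r0])
      set E := B * Z r0 with hEdef
      have hw : 0 < φ r0 + E := by linarith
      rw [← heq] at hineq
      have hode := hφ.ode r0 h0
      have htan := rpow_tangent hp1 hφ0.le hw
      have hmon : φ r0 ^ (p - 1) ≤ (φ r0 + E) ^ (p - 1) :=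
        Real.rpow_le_rpow hφ0.le (by linarith) (by linarith)
      have hcw0 := hcw r0 h0
      set Y := (φ r0 + E) ^ (p - 1) with hY
      have hlap : Real.exp (-r0) + 2 + ((n : ℝ) - 1) / r0 * Z' r0 ≤ 2 * n + 1 := by
        simp only [hZ']
        have e1 : ((n : ℝ) - 1) / r0 * (-Real.exp (-r0) + 2 * r0) =
          -(((n : ℝ) - 1) / r0 * Real.exp (-r0)) + 2 * ((n : ℝ) - 1) := by field_simp
        have e2 : 0 ≤ ((n : ℝ) - 1) / r0 * Real.exp (-r0) :=
          mul_nonneg (div_nonneg (by linarith) hr0) (Real.exp_pos _).le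
        have e3 : Real.exp (-r0) ≤ 1 := Real.exp_le_one_iff.mpr (by linarith)
        rw [e1]; linarith
      have hmain : p * Y * (K - 1) * E ≤ B * (2 * n + 1) := by
        have := mul_le_mul_of_nonneg_left hlap hBpos.le
        linarith
      -- contradiction
      have h1 : c ≤ Y * (1 + r0 ^ 2) := hcw0.trans (by gcongr)
      have hYp : 0 < Y := Real.rpow_pos_of_pos hw _
      have h2 : B * (c * p * (K - 1)) ≤ p * Y * (K - 1) * E := by
        have hK1 : 0 < K - 1 := by
          have : 0 < (2 * (n : ℝ) + 1) / (p * c) := div_pos (by linarith) hpc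
          linarith
        calc B * (c * p * (K - 1)) ≤ B * ((Y * (1 + r0 ^ 2)) * p * (K - 1)) := by gcongr
          _ ≤ B * ((Y * Z r0) * p * (K - 1)) := by gcongr
          _ = _ := by rw [hEdef]; ring
      have h3 : c * p * (K - 1) = c * p + (2 * n + 1) := by
        rw [hKdef]; field_simp; ring
      rw [h3] at h2
      have h4 := h2.trans hmain
      have h5 := le_of_mul_le_mul_left h4 hBpos
      nlinarith
  intro r hr t ht
  rcases ht.eq_or_lt with h | h
  · rw [← h, hv.init r hr]; exact hup r hr
  · have hlim : Tendsto (fun δ : ℝ => φ r + δ * Real.exp (K * t) * Z r) (𝓝[>] 0) (𝓝 (φ r)) := by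
      have : Continuous (fun δ : ℝ => φ r + δ * Real.exp (K * t) * Z r) := by fun_prop
      have := (this.tendsto 0).mono_left (nhdsWithin_le_nhds (s := Set.Ioi 0))
      simpa using this
    refine ge_of_tendsto hlim ?_
    filter_upwards [self_mem_nhdsWithin] with δ hδ
    exact key t h δ hδ r hr

lemma f_sub_pow {p f : ℝ} (hp1 : 1 < p) (h0 : 0 ≤ f) (h1 : f ≤ 1) :
    0 ≤ f - f ^ p ∧ f - f ^ p ≤ f ∧ f - f ^ p ≤ (p - 1) * (1 - f) := by
  refine ⟨?_, ?_, ?_⟩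
  · have := Real.rpow_le_rpow_of_exponent_ge_of_imp h0 h1 hp1.le (by intro _ h; linarith)
    rw [Real.rpow_one] at this; linarith
  · have := Real.rpow_nonneg h0 p; linarith
  · have := rpow_tangent hp1 h0 one_pos
    simp at this; linarith

lemma base_ineq {p f F0 D κ : ℝ} (hp1 : 1 < p) (h0 : 0 ≤ f) (h1 : f ≤ 1) (hF : 0 < F0)
    (hD : 0 < D) (hW : 0 ≤ F0 - D) (hκ : 0 < κ) :
    -(f - f ^ p) * F0 ^ p + κ * p * D * f * (F0 ^ (p - 1) - (F0 - D) ^ (p - 1)) ≤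
      f * (-F0 ^ p + (κ + 1) * (p * F0 ^ (p - 1)) * D) + ((F0 - D) * f) ^ p
        - p * ((F0 - D) * f) ^ (p - 1) * (κ * D * f) := by
  obtain ⟨a1, a2, a3⟩ := f_sub_pow hp1 h0 h1
  have htan := rpow_tangent hp1 hW hF
  have hfp : f ^ (p - 1) * f = f ^ p := by
    rcases h0.eq_or_lt with h | h
    · rw [← h, mul_zero, Real.zero_rpow (by linarith)]
    · rw [← Real.rpow_add_one h.ne']; ring_nf
  rw [Real.mul_rpow hW h0, Real.mul_rpow hW h0]
  have hfpn : 0 ≤ f ^ p := Real.rpow_nonneg h0 p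
  have hHn : 0 ≤ (F0 - D) ^ (p - 1) := Real.rpow_nonneg hW _
  have hGn : 0 < F0 ^ (p - 1) := Real.rpow_pos_of_pos hF _
  set G := F0 ^ (p - 1)
  set H := (F0 - D) ^ (p - 1)
  set Wp := (F0 - D) ^ p
  set Fp := F0 ^ p
  set fp := f ^ p
  have e : p * (H * f ^ (p - 1)) * (κ * D * f) = p * κ * D * H * fp := by rw [← hfp]; ring
  rw [e]
  have t1 : fp * (Fp + p * G * (F0 - D - F0)) ≤ fp * Wp := mul_le_mul_of_nonneg_left htan hfpn
  have t2 : 0 ≤ p * G * D * (f - fp) := by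
    have : 0 < p := by linarith
    positivity
  have t3 : 0 ≤ p * κ * D * H * (f - fp) := by
    have : 0 < p := by linarith
    positivity
  nlinarith

lemma sub_reduce {n : ℕ} {p r q A k κ d φ0 φ1 φ2 ψ0 ψ1 ψ2 f e x : ℝ} (hp1 : 1 < p) (hr : 0 < r)
    (hq : 0 < q) (hA : 0 < A) (he : 0 < e) (hκ : 0 < κ) (hd : 0 < d) (hφ0 : 0 < φ0) (hφ1 : φ1 ≤ 0) (hψ0 : 0 < ψ0)
    (hode : φ2 + ((n : ℝ) - 1) / r * φ1 + φ0 ^ p = 0)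
    (hψ : (κ + 1) * (p * φ0 ^ (p - 1)) * ψ0 ≤ -(ψ2 + ((n : ℝ) - 1) / r * ψ1))
    (hW : 0 ≤ φ0 - d * ψ0) (hf0 : 0 ≤ f) (hf1 : f ≤ 1)
    (hineq : ((φ2 - d * ψ2) * f + 2 * (φ1 - d * ψ1) * (-2 * q * r * A * e)
        + (φ0 - d * ψ0) * (-2 * q * A * e + 4 * q * x * A * e))
      + ((n : ℝ) - 1) / r * ((φ1 - d * ψ1) * f + (φ0 - d * ψ0) * (-2 * q * r * A * e))
      + ((φ0 - d * ψ0) * f) ^ p ≤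
        p * ((φ0 - d * ψ0) * f) ^ (p - 1) *
          (κ * (d * ψ0) * f + (φ0 - d * ψ0) * (-2 * k * x * A * e))) :
    -(f - f ^ p) * φ0 ^ p + κ * p * (d * ψ0) * f * (φ0 ^ (p - 1) - (φ0 - d * ψ0) ^ (p - 1))
      + 4 * d * ψ1 * q * r * A * e + (φ0 - d * ψ0) * q * A * e * (4 * x - 2 * n)
      + 2 * k * p * A * e * x * ((φ0 - d * ψ0) * f) ^ (p - 1) * (φ0 - d * ψ0) ≤ 0 := by
  have hb := base_ineq hp1 hf0 hf1 hφ0 (mul_pos hd hψ0) hW hκ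
  have h1 : 0 ≤ -φ1 * (q * r * A * e) := by
    have : 0 ≤ -φ1 := by linarith
    positivity
  have h2 := mul_le_mul_of_nonneg_left hψ (mul_nonneg hd.le hf0)
  have h3 : ((n : ℝ) - 1) / r * ((φ0 - d * ψ0) * (-2 * q * r * A * e)) =
      -2 * ((n : ℝ) - 1) * q * A * e * (φ0 - d * ψ0) := by field_simp
  set W := φ0 - d * ψ0
  set Y := (W * f) ^ (p - 1)
  set N := ((n : ℝ) - 1) / r
  have h4 : N * ((φ1 - d * ψ1) * f + W * (-2 * q * r * A * e)) =
    N * φ1 * f - N * ψ1 * d * f - 2 * ((n : ℝ) - 1) * q * A * e * W := by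
    rw [mul_add, h3]; ring
  rw [h4] at hineq
  have h5 : φ2 * f + N * φ1 * f + φ0 ^ p * f = 0 := by linear_combination f * hode
  linarith

set_option maxHeartbeats 1000000 in
lemma outer_ineq {n : ℕ} {p r q A k γ W F0 D Λ c X0 f e e0 f0 x : ℝ} (hp1 : 1 < p)
    (hr : 0 < r) (hq : 0 < q) (hA : 1 ≤ A) (hx : x = q * r ^ 2) (hγ : 0 < γ)
    (hW : 0 < W) (hD : D ≤ W) (hF : 0 < F0) (hFW : F0 ≤ 2 * W) (hk : 0 < k)
    (hΛ : F0 ^ (p - 1) * r ^ 2 ≤ Λ) (hΛ0 : 0 < Λ) (hc : c ≤ W ^ (p - 1) * r ^ 2) (hc0 : 0 < c)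
    (he : 0 < e) (he1 : e ≤ 1) (hf : f = 1 - A + A * e) (hf0 : 0 ≤ f) (hex : 1 - e ≤ x)
    (hX1 : 1 ≤ X0) (hX : Λ + 2 * γ + n < 2 * X0) (hf0p : 0 < f0)
    (hlow : x ≤ X0 → e0 ≤ e ∧ f0 ≤ f) (he0 : 0 < e0)
    (hkb : 2 * (p - 1) * Λ + 4 * γ + 2 * n < 2 * k * p * c * e0 * f0 ^ (p - 1)) :
    0 < -(f - f ^ p) * F0 ^ p - 4 * γ * q * A * e * D + W * q * A * e * (4 * x - 2 * n)
      + 2 * k * p * A * e * x * (W * f) ^ (p - 1) * W := by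
  have hA0 : 0 < A := by linarith
  have hp0 : 0 < p := by linarith
  have hn0 : (0 : ℝ) ≤ n := Nat.cast_nonneg n
  have hxp : 0 < x := by rw [hx]; positivity
  have hf1 : f ≤ 1 := by rw [hf]; nlinarith
  obtain ⟨a1, a2, a3⟩ := f_sub_pow hp1 hf0 hf1
  have hGF : F0 ^ p = F0 ^ (p - 1) * F0 := by
    rw [← Real.rpow_add_one hF.ne']; ring_nf
  rw [hGF, Real.mul_rpow hW.le hf0]
  set G := F0 ^ (p - 1) with hGd
  set H := W ^ (p - 1) with hHd
  have hG0 : 0 < G := Real.rpow_pos_of_pos hF _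
  have hH0 : 0 < H := Real.rpow_pos_of_pos hW _
  have hGx : G * x ≤ q * Λ := by rw [hx]; nlinarith
  have hHx : q * c ≤ H * x := by rw [hx]; nlinarith
  have hfpn : 0 ≤ f ^ (p - 1) := Real.rpow_nonneg hf0 _
  set u := f - f ^ p with hu
  have hT1 : u * (G * F0) ≤ u * (G * (2 * W)) := by gcongr
  have hT2 : 4 * γ * q * A * e * D ≤ 4 * γ * q * A * e * W := by gcongr
  rcases le_total X0 x with h | h
  · have hG1 : G ≤ q * Λ := by nlinarith
    have huA : u ≤ A * e := by rw [hf] at a2; linarith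
    have hT3 : u * (G * (2 * W)) ≤ (A * e) * ((q * Λ) * (2 * W)) := by gcongr
    have hT4 : 0 ≤ 2 * k * p * A * e * x * (H * f ^ (p - 1)) * W := by positivity
    have hfin : 0 < W * q * A * e * (4 * x - 2 * n - 4 * γ - 2 * Λ) := by
      apply mul_pos (by positivity); linarith
    linarith
  · obtain ⟨b1, b2⟩ := hlow h
    have huA : u ≤ (p - 1) * (A * x) := by
      refine a3.trans ?_
      have : 1 - f ≤ A * x := by rw [hf]; nlinarith
      exact mul_le_mul_of_nonneg_left this (by linarith)
    have hp1' : 0 ≤ p - 1 := by linarith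
    have hT3 : u * (G * (2 * W)) ≤ (p - 1) * A * (2 * W) * (q * Λ) := by
      calc u * (G * (2 * W)) ≤ ((p - 1) * (A * x)) * (G * (2 * W)) := by gcongr
        _ = (p - 1) * A * (2 * W) * (G * x) := by ring
        _ ≤ _ := by gcongr
    have hff : f0 ^ (p - 1) ≤ f ^ (p - 1) := Real.rpow_le_rpow hf0p.le b2 hp1'
    have hf0n : 0 < f0 ^ (p - 1) := Real.rpow_pos_of_pos hf0p _
    have hT4 : (2 * k * p * A * W) * (e0 * f0 ^ (p - 1) * (q * c)) ≤
        2 * k * p * A * e * x * (H * f ^ (p - 1)) * W := by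
      calc (2 * k * p * A * W) * (e0 * f0 ^ (p - 1) * (q * c))
          ≤ (2 * k * p * A * W) * (e * f ^ (p - 1) * (H * x)) := by gcongr
        _ = _ := by ring
    have hT5 : 4 * γ * q * A * e * W ≤ 4 * γ * q * A * 1 * W := by gcongr
    have hT6 : -(W * q * A * (2 * n)) ≤ W * q * A * e * (4 * x - 2 * n) := by
      have i1 : 0 ≤ W * q * A * e * (4 * x) := by positivity
      have i2 : W * q * A * e * (2 * n) ≤ W * q * A * 1 * (2 * n) := by gcongr
      linarith
    have hfin : 0 < W * q * A * (2 * k * p * c * e0 * f0 ^ (p - 1) -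
        (2 * (p - 1) * Λ + 4 * γ + 2 * n)) := by
      apply mul_pos (by positivity); linarith
    linarith

lemma inner_ineq {n : ℕ} {p r q A k κ α W F0 D D0 m0 dΨ dψ1 R f e x : ℝ} (hp1 : 1 < p)
    (hr : 0 < r) (hrR : r ≤ R) (hq : 0 < q) (hA : 0 < A) (hx : x = q * r ^ 2) (hκ : 0 < κ)
    (hW : 0 ≤ W) (hWα : W ≤ α) (hF : 0 < F0) (hFα : F0 ≤ α) (hk : 0 < k)
    (hD : D0 ≤ D) (hD0 : 0 < D0) (hm0 : 0 < m0) (hm : m0 ≤ F0 ^ (p - 1) - W ^ (p - 1))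
    (he : 0 < e) (he1 : e ≤ 1) (hf : f = 1 - A + A * e) (hex : 1 - e ≤ x)
    (hψ : -dΨ ≤ dψ1) (hΨ : 0 ≤ dΨ) (hAx : A * (q * R ^ 2) ≤ 1 / 2)
    (hsmall : q * (A * ((p - 1) * R ^ 2 * α ^ p + 4 * dΨ * R + 2 * n * α)) < κ * p * D0 * m0 / 2) :
    0 < -(f - f ^ p) * F0 ^ p + κ * p * D * f * (F0 ^ (p - 1) - W ^ (p - 1))
      + 4 * dψ1 * q * r * A * e + W * q * A * e * (4 * x - 2 * n)
      + 2 * k * p * A * e * x * (W * f) ^ (p - 1) * W := by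
  have hp0 : 0 < p := by linarith
  have hp1' : 0 ≤ p - 1 := by linarith
  have hn0 : (0 : ℝ) ≤ n := Nat.cast_nonneg n
  have hR : 0 < R := by linarith
  have hxp : 0 < x := by rw [hx]; positivity
  have hxR : x ≤ q * R ^ 2 := by rw [hx]; gcongr
  have hAx' : A * x ≤ 1 / 2 := le_trans (by gcongr) hAx
  have h1f : 1 - f ≤ A * x := by rw [hf]; nlinarith
  have hf2 : 1 / 2 ≤ f := by linarith
  have hf1 : f ≤ 1 := by rw [hf]; nlinarith
  obtain ⟨a1, a2, a3⟩ := f_sub_pow hp1 (by linarith) hf1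
  have hα : 0 < α := by linarith
  have hFp : F0 ^ p ≤ α ^ p := Real.rpow_le_rpow hF.le hFα hp0.le
  have hFp0 : 0 < F0 ^ p := Real.rpow_pos_of_pos hF _
  have t1 : (f - f ^ p) * F0 ^ p ≤ (p - 1) * (A * (q * R ^ 2)) * α ^ p := by
    have i1 : f - f ^ p ≤ (p - 1) * (A * (q * R ^ 2)) := by
      refine a3.trans (mul_le_mul_of_nonneg_left (h1f.trans ?_) hp1')
      gcongr
    gcongr
  have t2 : κ * p * D0 * (1 / 2) * m0 ≤
      κ * p * D * f * (F0 ^ (p - 1) - W ^ (p - 1)) := by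
    have : 0 < D := by linarith
    have : 0 < f := by linarith
    gcongr
  have t3 : -(4 * dΨ * q * R * A) ≤ 4 * dψ1 * q * r * A * e := by
    have i1 : -dΨ * (4 * q * r * A * e) ≤ dψ1 * (4 * q * r * A * e) := by gcongr
    have i2 : dΨ * (4 * q * r * A * e) ≤ dΨ * (4 * q * R * A * 1) := by gcongr
    linarith
  have t4 : -(α * q * A * (2 * n)) ≤ W * q * A * e * (4 * x - 2 * n) := by
    have i1 : 0 ≤ W * q * A * e * (4 * x) := by positivity
    have i2 : W * q * A * e * (2 * n) ≤ α * q * A * 1 * (2 * n) := by gcongr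
    linarith
  have t5 : 0 ≤ 2 * k * p * A * e * x * (W * f) ^ (p - 1) * W := by
    have : 0 ≤ W * f := mul_nonneg hW (by linarith)
    positivity
  linarith

lemma m0_exists {p α D0 : ℝ} (hp1 : 1 < p) (hα : 0 < α) (hD0 : 0 < D0) :
    ∃ m0 > 0, ∀ F D : ℝ, F ≤ α → D0 ≤ D → 0 ≤ F - D →
      m0 ≤ F ^ (p - 1) - (F - D) ^ (p - 1) := by
  have hp : 0 < p - 1 := by linarith
  rcases le_or_gt D0 α with h | h
  · have hb0 : 0 ≤ 1 - D0 / α := by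
      have : D0 / α ≤ 1 := (div_le_one hα).mpr h
      linarith
    have hb1 : 1 - D0 / α < 1 := by
      have : 0 < D0 / α := by positivity
      linarith
    have hlt : (1 - D0 / α) ^ (p - 1) < 1 := Real.rpow_lt_one hb0 hb1 hp
    have hDp : 0 < D0 ^ (p - 1) := Real.rpow_pos_of_pos hD0 _
    refine ⟨D0 ^ (p - 1) * (1 - (1 - D0 / α) ^ (p - 1)), mul_pos hDp (by linarith), ?_⟩
    intro F D hF hD hFD
    have hFp : 0 < F := by linarith
    have h1 : F - D ≤ F * (1 - D0 / α) := by
      have : F * (D0 / α) ≤ α * (D0 / α) := by gcongr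
      rw [mul_div_cancel₀ _ hα.ne'] at this
      linarith
    have h2 : (F - D) ^ (p - 1) ≤ F ^ (p - 1) * (1 - D0 / α) ^ (p - 1) := by
      rw [← Real.mul_rpow hFp.le hb0]
      exact Real.rpow_le_rpow hFD h1 hp.le
    have h3 : D0 ^ (p - 1) ≤ F ^ (p - 1) := Real.rpow_le_rpow hD0.le (by linarith) hp.le
    nlinarith
  · exact ⟨1, one_pos, fun F D hF hD hFD => by linarith⟩

/-- The bounded spatial profile of the barrier: tangent line up to `ε`, then `r^{-γ}`. -/
def psiB (γ ε r : ℝ) : ℝ :=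
  ε ^ (-γ) * (γ - γ * (min r ε) / ε) + (max r ε) ^ (-γ)

lemma psiB_inner {γ ε r : ℝ} (h : r ≤ ε) :
    psiB γ ε r = ε ^ (-γ) * (1 + γ - γ * r / ε) := by
  rw [psiB, min_eq_left h, max_eq_right h]; ring

lemma psiB_outer {γ ε r : ℝ} (hε : 0 < ε) (h : ε ≤ r) : psiB γ ε r = r ^ (-γ) := by
  rw [psiB, min_eq_right h, max_eq_left h]; field_simp; ring

lemma psiB_cont {γ ε : ℝ} (hε : 0 < ε) : Continuous (psiB γ ε) := by
  unfold psiB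
  have h : Continuous (fun r : ℝ => (max r ε) ^ (-γ)) := by
    apply Continuous.rpow_const (by fun_prop)
    intro r; left; exact (lt_of_lt_of_le hε (le_max_right _ _)).ne'
  fun_prop

lemma psiB_le {γ ε r : ℝ} (hγ : 0 < γ) (hε : 0 < ε) (hr : 0 < r) : psiB γ ε r ≤ r ^ (-γ) := by
  rcases le_total r ε with h | h
  · rw [psiB_inner h]
    have hx : 0 < r / ε := by positivity
    have h1 : 1 + γ - γ * r / ε ≤ (r / ε) ^ (-γ) := by
      rw [Real.rpow_def_of_pos hx]
      have a := Real.add_one_le_exp (Real.log (r / ε) * -γ)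
      have b := Real.log_le_sub_one_of_pos hx
      have c := mul_le_mul_of_nonneg_left b hγ.le
      have e : γ * r / ε = γ * (r / ε) := by ring
      rw [e]; linarith
    calc ε ^ (-γ) * (1 + γ - γ * r / ε) ≤ ε ^ (-γ) * (r / ε) ^ (-γ) := by gcongr
      _ = r ^ (-γ) := by
        rw [← Real.mul_rpow hε.le hx.le, mul_div_cancel₀ _ hε.ne']
  · rw [psiB_outer hε h]

lemma psiB_lower {γ ε r : ℝ} (hγ : 0 < γ) (hε : 0 < ε) (hε1 : ε ≤ 1) (hr : 0 ≤ r) :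
    (r + 1) ^ (-γ) ≤ psiB γ ε r := by
  rcases le_total r ε with h | h
  · rw [psiB_inner h]
    have h1 : (r + 1) ^ (-γ) ≤ ε ^ (-γ) :=
      Real.rpow_le_rpow_of_nonpos hε (by linarith) (by linarith)
    have h2 : γ * r / ε ≤ γ := by
      rw [div_le_iff₀ hε]; gcongr
    have h3 := Real.rpow_pos_of_pos hε (-γ)
    nlinarith
  · rw [psiB_outer hε h]
    exact Real.rpow_le_rpow_of_nonpos (by linarith) (by linarith) (by linarith)

lemma psiB_upper {γ ε r : ℝ} (hγ : 0 < γ) (hε : 0 < ε) (hr : 0 ≤ r) :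
    psiB γ ε r ≤ ε ^ (-γ) * (1 + γ) := by
  have h3 := Real.rpow_pos_of_pos hε (-γ)
  rcases le_total r ε with h | h
  · rw [psiB_inner h]
    have : 0 ≤ γ * r / ε := by positivity
    gcongr; linarith
  · rw [psiB_outer hε h]
    have : r ^ (-γ) ≤ ε ^ (-γ) := Real.rpow_le_rpow_of_nonpos hε h (by linarith)
    nlinarith

lemma psiB_slope0 {γ ε : ℝ} (hε : 0 < ε) :
    HasDerivWithinAt (psiB γ ε) (-(ε ^ (-γ) * (γ / ε))) (Set.Ici 0) 0 := by
  have h : HasDerivAt (fun r : ℝ => ε ^ (-γ) * (1 + γ - γ * r / ε)) (-(ε ^ (-γ) * (γ / ε))) 0 := by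
    have := (((((hasDerivAt_id (0:ℝ)).const_mul γ).div_const ε).const_sub (1 + γ)).const_mul
      (ε ^ (-γ)))
    refine this.congr_deriv ?_
    ring
  have h2 : psiB γ ε =ᶠ[𝓝 0] (fun r : ℝ => ε ^ (-γ) * (1 + γ - γ * r / ε)) := by
    filter_upwards [Iio_mem_nhds hε] with r hr
    exact psiB_inner (le_of_lt hr)
  exact (h.congr_of_eventuallyEq h2).hasDerivWithinAt

lemma psiB_local {n : ℕ} {γ ε r0 V Vm : ℝ} (hγ : 0 < γ) (hε : 0 < ε) (hr0 : 0 < r0)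
    (hn1 : (1 : ℝ) ≤ n)
    (hV0 : 0 ≤ V) (hV1 : V * r0 ^ 2 ≤ γ * ((n : ℝ) - 2 - γ)) (hV2 : V ≤ Vm)
    (hVε : Vm * (1 + γ) * ε ^ 2 ≤ γ * ((n : ℝ) - 1)) :
    ∃ (ψ ψ' : ℝ → ℝ) (ψ2 : ℝ), (∀ᶠ r in 𝓝 r0, HasDerivAt ψ (ψ' r) r) ∧ HasDerivAt ψ' ψ2 r0 ∧
      ψ r0 = psiB γ ε r0 ∧ (∀ᶠ r in 𝓝 r0, psiB γ ε r ≤ ψ r ∧ (ε ≤ r → psiB γ ε r = ψ r)) ∧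
      V * psiB γ ε r0 ≤ -(ψ2 + ((n : ℝ) - 1) / r0 * ψ' r0) ∧
      -(ε ^ (-γ) * (γ / ε)) ≤ ψ' r0 ∧ (ε ≤ r0 → ψ' r0 = -γ * psiB γ ε r0 / r0) := by
  have h3 := Real.rpow_pos_of_pos hε (-γ)
  rcases lt_or_ge r0 ε with h | h
  · refine ⟨fun r => ε ^ (-γ) * (1 + γ - γ * r / ε), fun _ => -(ε ^ (-γ) * (γ / ε)), 0,
      ?_, hasDerivAt_const _ _, (psiB_inner h.le).symm, ?_, ?_, le_rfl, fun h' => by linarith⟩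
    · refine Eventually.of_forall fun r => ?_
      have := (((((hasDerivAt_id r).const_mul γ).div_const ε).const_sub (1 + γ)).const_mul
        (ε ^ (-γ)))
      refine this.congr_deriv ?_
      ring
    · filter_upwards [Iio_mem_nhds h] with r hr
      have hr : r < ε := hr
      exact ⟨(psiB_inner hr.le).le, fun h' => by linarith⟩
    · have h4 := psiB_upper hγ hε hr0.le
      have h5 : V * psiB γ ε r0 ≤ Vm * (ε ^ (-γ) * (1 + γ)) := by
        have : 0 ≤ psiB γ ε r0 := by
          rw [psiB_inner h.le]
          have : γ * r0 / ε ≤ γ := by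
            rw [div_le_iff₀ hε]; gcongr
          apply mul_nonneg h3.le; linarith
        gcongr
        linarith
      have h6 : Vm * (1 + γ) ≤ ((n : ℝ) - 1) / r0 * (γ / ε) := by
        have e : ((n : ℝ) - 1) / r0 * (γ / ε) = γ * ((n : ℝ) - 1) / (r0 * ε) := by
          field_simp
        rw [e, le_div_iff₀ (by positivity)]
        refine le_trans ?_ hVε
        have : 0 ≤ Vm * (1 + γ) := mul_nonneg (by linarith) (by linarith)
        rw [pow_two]
        gcongr
      have h7 := mul_le_mul_of_nonneg_left h6 h3.le
      linarith
  · have hd : ∀ r > 0, ∀ s : ℝ, HasDerivAt (fun r : ℝ => r ^ s) (s * r ^ (s - 1)) r :=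
      fun r hr s => Real.hasDerivAt_rpow_const (Or.inl (ne_of_gt hr))
    refine ⟨fun r => r ^ (-γ), fun r => -γ * r ^ (-γ - 1), -γ * ((-γ - 1) * r0 ^ (-γ - 1 - 1)),
      ?_, (hd r0 hr0 _).const_mul _, (psiB_outer hε h).symm, ?_, ?_, ?_, ?_⟩
    · filter_upwards [Ioi_mem_nhds hr0] with r hr using hd r hr _
    · filter_upwards [Ioi_mem_nhds hr0] with r hr
      exact ⟨psiB_le hγ hε hr, fun h' => psiB_outer hε h'⟩
    · rw [psiB_outer hε h]
      have e1 : r0 ^ (-γ - 1) = r0 ^ (-γ - 1 - 1) * r0 := by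
        rw [← Real.rpow_add_one hr0.ne']; ring_nf
      have e2 : r0 ^ (-γ) = r0 ^ (-γ - 1 - 1) * r0 ^ 2 := by
        rw [← Real.rpow_natCast r0 2, ← Real.rpow_add hr0]; norm_num; ring_nf
      have e3 : ((n : ℝ) - 1) / r0 * (-γ * (r0 ^ (-γ - 1 - 1) * r0)) =
        ((n : ℝ) - 1) * (-γ * r0 ^ (-γ - 1 - 1)) := by field_simp
      beta_reduce
      rw [e2, e1, e3]
      have h8 := Real.rpow_pos_of_pos hr0 (-γ - 1 - 1)
      have := mul_le_mul_of_nonneg_left hV1 h8.le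
      linarith
    · have e1 : ε ^ (-γ) * (γ / ε) = γ * ε ^ (-γ - 1) := by
        rw [Real.rpow_sub_one hε.ne']; ring
      have : r0 ^ (-γ - 1) ≤ ε ^ (-γ - 1) := Real.rpow_le_rpow_of_nonpos hε h (by linarith)
      rw [e1]; nlinarith
    · intro _
      beta_reduce
      rw [psiB_outer hε h, Real.rpow_sub_one hr0.ne']; ring

set_option maxHeartbeats 2000000 in
lemma lower_aux {n : ℕ} (hn : 10 < n) {p α a : ℝ} (hp1 : 1 < p) (hα : 0 < α)
    (hL : 0 < Lconst n p) {φ : ℝ → ℝ} (hφ : IsSteadyStateA n p α φ a)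
    {v₀ : ℝ → ℝ} {γ κ ε b C0 R A X0 k T D0 m0 μ c : ℝ} (hγ : 0 < γ) (hκ : 0 < κ)
    (hκγ : (κ + 1) * (p * Lconst n p ^ (p - 1)) = γ * ((n : ℝ) - 2 - γ))
    (hε : 0 < ε) (hε1 : ε ≤ 1)
    (hVε : (κ + 1) * (p * α ^ (p - 1)) * (1 + γ) * ε ^ 2 ≤ γ * ((n : ℝ) - 1))
    (hb : 0 < b) (hbC : b < C0) (hR1 : 1 ≤ R)
    (hRφ : ∀ r ≥ R, C0 * r ^ (-γ) ≤ φ r / 2)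
    (hRc : ∀ r ≥ R, c ≤ (φ r / 2) ^ (p - 1) * r ^ 2) (hc : 0 < c)
    (hA : 1 ≤ A) (hX1 : 1 ≤ X0) (hX : Lconst n p ^ (p - 1) + 2 * γ + n < 2 * X0)
    (hAX : A * Real.exp (-(X0 + 1)) = A - 1) (hk : 0 < k)
    (hf0 : 0 < 1 - A + A * Real.exp (-X0))
    (hkb : 2 * (p - 1) * Lconst n p ^ (p - 1) + 4 * γ + 2 * n <
      2 * k * p * c * Real.exp (-X0) * (1 - A + A * Real.exp (-X0)) ^ (p - 1))
    (hT : 0 < T) (hD0 : D0 = C0 * Real.exp (-κ * T) * (R + 1) ^ (-γ)) (hm0 : 0 < m0)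
    (hm : ∀ F D : ℝ, F ≤ α → D0 ≤ D → 0 ≤ F - D → m0 ≤ F ^ (p - 1) - (F - D) ^ (p - 1))
    (hμ : 0 < μ) (hμ1 : A * ((μ * Real.exp (2 * k * T)) * R ^ 2) ≤ 1 / 2)
    (hμ2 : (μ * Real.exp (2 * k * T)) * (A * ((p - 1) * R ^ 2 * α ^ p +
      4 * (C0 * (ε ^ (-γ) * (γ / ε))) * R + 2 * n * α)) < κ * p * D0 * m0 / 2)
    (hnonneg : ∀ r ≥ (0 : ℝ), 0 ≤ v₀ r)
    (hlow : ∀ r ≥ (0 : ℝ), φ r - b * (r + 1) ^ (-γ) ≤ v₀ r)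
    {v : ℝ → ℝ → ℝ} (hv : IsRadialSol n p v v₀) (r : ℝ) (hr : 0 ≤ r) :
    (φ r - C0 * Real.exp (-κ * T) * psiB γ ε r) *
      (1 - A + A * Real.exp (-(μ * Real.exp (2 * k * T) * r ^ 2))) ≤ v r T := by
  by_contra hcon
  push Not at hcon
  have hn' : (11 : ℝ) ≤ n := by exact_mod_cast hn
  have hA0 : 0 < A := by linarith
  have hC0 : 0 < C0 := by linarith
  have hR0 : 0 < R := by linarith
  have hp0 : 0 < p := by linarith
  set dd : ℝ → ℝ := fun t => C0 * Real.exp (-κ * t) with hdd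
  set qq : ℝ → ℝ := fun t => μ * Real.exp (2 * k * t) with hqq
  set FF : ℝ → ℝ → ℝ := fun r t => 1 - A + A * Real.exp (-(qq t * r ^ 2)) with hFF
  set WW : ℝ → ℝ → ℝ := fun r t => φ r - dd t * psiB γ ε r with hWW
  have hddp : ∀ t, 0 < dd t := fun t => mul_pos hC0 (Real.exp_pos _)
  have hdd1 : ∀ t ≥ 0, dd t ≤ C0 := by
    intro t ht
    have h1 : Real.exp (-κ * t) ≤ 1 :=
      Real.exp_le_one_iff.mpr (by have := mul_nonneg hκ.le ht; linarith)
    exact mul_le_of_le_one_right hC0.le h1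
  have hddT : ∀ t ≤ T, C0 * Real.exp (-κ * T) ≤ dd t := by
    intro t ht
    have h1 : Real.exp (-κ * T) ≤ Real.exp (-κ * t) :=
      Real.exp_le_exp.mpr (by have := mul_le_mul_of_nonneg_left ht hκ.le; linarith)
    exact mul_le_mul_of_nonneg_left h1 hC0.le
  have hqp : ∀ t, 0 < qq t := fun t => mul_pos hμ (Real.exp_pos _)
  have hqT : ∀ t ≤ T, qq t ≤ μ * Real.exp (2 * k * T) := by
    intro t ht; simp only [hqq]; gcongr
  have hqμ : ∀ t ≥ 0, μ ≤ qq t := by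
    intro t ht
    have : 1 ≤ Real.exp (2 * k * t) := Real.one_le_exp (by positivity)
    exact le_mul_of_one_le_right hμ.le this
  have hexpx : ∀ x : ℝ, 1 - Real.exp (-x) ≤ x := fun x => by
    have := Real.add_one_le_exp (-x); linarith
  have hF1 : ∀ r t, FF r t ≤ 1 := by
    intro r t
    have : Real.exp (-(qq t * r ^ 2)) ≤ 1 :=
      Real.exp_le_one_iff.mpr (neg_nonpos.mpr (mul_nonneg (hqp t).le (sq_nonneg r)))
    have h2 := mul_le_mul_of_nonneg_left this hA0.le
    simp only [hFF]; linarith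
  have hFin : ∀ r, 0 ≤ r → r ≤ R → ∀ t ≤ T, 1 / 2 ≤ FF r t := by
    intro r hr0 hr t ht
    have h1 := hexpx (qq t * r ^ 2)
    have h2 : A * (qq t * r ^ 2) ≤ A * ((μ * Real.exp (2 * k * T)) * R ^ 2) := by
      have := hqT t ht
      gcongr
    have h3 := mul_le_mul_of_nonneg_left h1 hA0.le
    simp only [hFF]; linarith
  have hpsi_pos : ∀ r ≥ 0, 0 < psiB γ ε r := fun r hr =>
    lt_of_lt_of_le (Real.rpow_pos_of_pos (by linarith) _) (psiB_lower hγ hε hε1 hr)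
  have hWout : ∀ r ≥ R, ∀ t ≥ 0, dd t * psiB γ ε r ≤ φ r / 2 := by
    intro r hr t ht
    refine le_trans ?_ (hRφ r hr)
    have h1 := psiB_le hγ hε (show 0 < r by linarith)
    have h2 := hdd1 t ht
    have h3 := (hpsi_pos r (by linarith)).le
    gcongr
  have hWoutp : ∀ r ≥ R, ∀ t ≥ 0, 0 < WW r t := by
    intro r hr t ht
    have h1 := hWout r hr t ht
    have h2 := hφ.pos r (by linarith)
    simp only [hWW]; linarith
  set Ro := max (r + 1) (max (R + 1) (Real.sqrt ((X0 + 2) / μ))) with hRo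
  have hrRo : r < Ro := lt_of_lt_of_le (by linarith) (le_max_left _ _)
  have hRRo : R < Ro := lt_of_lt_of_le (by linarith) ((le_max_left _ _).trans (le_max_right _ _))
  have hRo0 : 0 < Ro := by linarith
  have hRoX : X0 + 2 ≤ μ * Ro ^ 2 := by
    have h1 : Real.sqrt ((X0 + 2) / μ) ≤ Ro := (le_max_right _ _).trans (le_max_right _ _)
    have h2 := pow_le_pow_left₀ (Real.sqrt_nonneg _) h1 2
    rw [Real.sq_sqrt (by positivity), div_le_iff₀ hμ] at h2
    linarith
  set g : ℝ × ℝ → ℝ := fun q => v q.1 q.2 - WW q.1 q.2 * FF q.1 q.2 with hg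
  obtain ⟨r0, t0, hr0, hr0R, ht0, ht0T, hg0, hgnn⟩ := first_touch (g := g) (R := Ro) (T := T)
    (by
      apply ContinuousOn.sub (v_cont_slice hv Ro T)
      apply ContinuousOn.mul
      · apply ContinuousOn.sub
        · exact (hφ.cont.mono Set.Icc_subset_Ici_self).comp continuousOn_fst (fun q hq => hq.1)
        · have := psiB_cont (γ := γ) hε
          apply Continuous.continuousOn; fun_prop
      · apply Continuous.continuousOn; fun_prop)
    (by
      intro s hs
      have h1 := hlow s hs.1
      have h2 := hv.init s hs.1
      have h3 := hnonneg s hs.1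
      simp only [hg]
      rw [h2, sub_pos]
      rcases lt_or_ge (WW s 0) 0 with h | h
      · have hsR : s ≤ R := by
          by_contra hc'
          push Not at hc'
          have := hWoutp s hc'.le 0 le_rfl
          linarith
        have h4 := hFin s hs.1 hsR 0 hT.le
        have : WW s 0 * FF s 0 < 0 := mul_neg_of_neg_of_pos h (by linarith)
        linarith
      · have h4 : WW s 0 * FF s 0 ≤ WW s 0 * 1 := mul_le_mul_of_nonneg_left (hF1 s 0) h
        have h5 : WW s 0 < φ s - b * (s + 1) ^ (-γ) := by
          have h6 := psiB_lower hγ hε hε1 hs.1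
          have h7 : 0 < (s + 1) ^ (-γ) := Real.rpow_pos_of_pos (by linarith [hs.1]) _
          simp only [hWW, hdd, mul_zero, Real.exp_zero, mul_one]
          have h8 := mul_lt_mul_of_pos_right hbC h7
          have h9 := mul_le_mul_of_nonneg_left h6 hC0.le
          linarith
        linarith)
    (by
      intro t ht
      have h1 := hWoutp Ro hRRo.le t ht.1
      have h2 := hv.nonneg Ro hRo0.le t ht.1
      have h3 : FF Ro t < 0 := by
        have h4 : X0 + 1 < qq t * Ro ^ 2 := by
          have := hqμ t ht.1
          have : μ * Ro ^ 2 ≤ qq t * Ro ^ 2 := by gcongr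
          linarith
        have h5 : Real.exp (-(qq t * Ro ^ 2)) < Real.exp (-(X0 + 1)) :=
          Real.exp_lt_exp.mpr (by linarith)
        have h6 := mul_lt_mul_of_pos_left h5 hA0
        simp only [hFF]; linarith
      have h4 := mul_neg_of_pos_of_neg h1 h3
      simp only [hg]; linarith)
    ⟨r, ⟨hr, hrRo.le⟩, T, ⟨hT.le, le_rfl⟩, by simp only [hg]; linarith⟩
  have heq : v r0 t0 = WW r0 t0 * FF r0 t0 := by
    have : v r0 t0 - WW r0 t0 * FF r0 t0 = 0 := hg0
    linarith
  have hvnn := hv.nonneg r0 hr0 t0 ht0.le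
  set d := dd t0 with hd
  set q := qq t0 with hq
  have hdp : 0 < d := hddp t0
  have hqpos : 0 < q := hqp t0
  have hFd : ∀ s, HasDerivAt (fun s => FF s t0) (-2 * q * s * A * Real.exp (-(q * s ^ 2))) s := by
    intro s
    have h1 : HasDerivAt (fun s : ℝ => -(q * s ^ 2)) (-(q * (2 * s))) s := by
      have := ((hasDerivAt_pow 2 s).const_mul q).neg
      refine this.congr_deriv ?_
      simp
    refine ((h1.exp.const_mul A).const_add (1 - A)).congr_deriv ?_
    ring
  rcases hr0.eq_or_lt with h0 | h0
  · subst h0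
    have hd' : HasDerivWithinAt (fun s => g (s, t0))
        (0 - ((0 - d * (-(ε ^ (-γ) * (γ / ε)))) * FF 0 t0 +
          WW 0 t0 * (-2 * q * 0 * A * Real.exp (-(q * 0 ^ 2))))) (Set.Ici 0) 0 :=
      (v_slope0 hv ht0).sub
        (((phi_slope0 hn hp1 hα hφ).sub ((psiB_slope0 hε).const_mul d)).mul
          (hFd 0).hasDerivWithinAt)
    refine no_touch_zero hRo0 ?_ hd' hg0 (fun s hs => hgnn s hs t0 ⟨ht0.le, le_rfl⟩)
    have h1 : 0 < d * (ε ^ (-γ) * (γ / ε)) := by positivity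
    have h2 := hFin 0 le_rfl hR0.le t0 ht0T
    have h3 : 0 < d * (ε ^ (-γ) * (γ / ε)) * FF 0 t0 := mul_pos h1 (by linarith)
    linarith
  · have hφ0 := hφ.pos r0 hr0
    have hφα : φ r0 ≤ α := by
      rw [← hφ.val0]; exact hφ.anti.antitoneOn (by simp) (Set.mem_Ici.mpr hr0) hr0
    have hφα' : φ r0 ^ (p - 1) ≤ α ^ (p - 1) := Real.rpow_le_rpow hφ0.le hφα (by linarith)
    have hΛ := phi_pow_upper hp1 hL hφ h0
    obtain ⟨ψ, ψ', ψ2, hψ1, hψ2, hψeq, hψle, hψV, hψs, hψo⟩ := psiB_local (n := n) (γ := γ)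
      (ε := ε) (r0 := r0) (V := (κ + 1) * (p * φ r0 ^ (p - 1)))
      (Vm := (κ + 1) * (p * α ^ (p - 1))) hγ hε h0 (by linarith) (by positivity)
      (by
        rw [← hκγ]
        calc (κ + 1) * (p * φ r0 ^ (p - 1)) * r0 ^ 2
            = (κ + 1) * (p * (φ r0 ^ (p - 1) * r0 ^ 2)) := by ring
          _ ≤ _ := by gcongr)
      (by gcongr) hVε
    set e := Real.exp (-(q * r0 ^ 2)) with he
    set f := FF r0 t0 with hf
    have hineq := touch_lower hp1 hv h0 ht0
      (wS := fun s => (φ s - d * ψ s) * FF s t0)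
      (wS' := fun s => (deriv φ s - d * ψ' s) * FF s t0 +
        (φ s - d * ψ s) * (-2 * q * s * A * Real.exp (-(q * s ^ 2))))
      (w2 := (deriv (deriv φ) r0 - d * ψ2) * f + 2 * (deriv φ r0 - d * ψ' r0) *
          (-2 * q * r0 * A * e) + (φ r0 - d * ψ r0) *
          (-2 * q * A * e + 4 * q * (q * r0 ^ 2) * A * e))
      (wT := fun t => WW r0 t * FF r0 t)
      (wt := κ * (d * psiB γ ε r0) * f + (φ r0 - d * psiB γ ε r0) *
        (-2 * k * (q * r0 ^ 2) * A * e))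
      (by
        filter_upwards [Ioi_mem_nhds h0, hψ1] with s hs hs2
        exact ((c2_hasDeriv hφ.smooth hs).1.sub (hs2.const_mul d)).mul (hFd s))
      (by
        have hE : HasDerivAt (fun s => -2 * q * s * A * Real.exp (-(q * s ^ 2)))
            (-2 * q * A * e + 4 * q * (q * r0 ^ 2) * A * e) r0 := by
          have h1 : HasDerivAt (fun s : ℝ => -(q * s ^ 2)) (-(q * (2 * r0))) r0 := by
            have := ((hasDerivAt_pow 2 r0).const_mul q).neg
            refine this.congr_deriv ?_
            simp
          have h2 := (((hasDerivAt_id r0).const_mul (-2 * q)).mul_const A).mul h1.exp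
          refine h2.congr_deriv ?_
          simp only [id, he]; ring
        have hφd := c2_hasDeriv hφ.smooth h0
        refine (((hφd.2.sub (hψ2.const_mul d)).mul (hFd r0)).add
          ((hφd.1.sub (hψ1.self_of_nhds.const_mul d)).mul hE)).congr_deriv ?_
        simp only [← hf, ← he, Pi.sub_apply]; ring)
      (by
        filter_upwards [Ioo_mem_nhds h0 hr0R, hψle] with s hs hs2
        have h1 := hgnn s ⟨hs.1.le, hs.2.le⟩ t0 ⟨ht0.le, le_rfl⟩
        simp only [hg, hWW] at h1
        have h2 : FF s t0 * psiB γ ε s ≤ FF s t0 * ψ s := by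
          rcases le_total ε s with h | h
          · rw [hs2.2 h]
          · have := hFin s hs.1.le (by linarith) t0 ht0T
            exact mul_le_mul_of_nonneg_left hs2.1 (by linarith)
        have h3 := mul_le_mul_of_nonneg_left h2 hdp.le
        linarith)
      (by simp only [hψeq]; exact heq.symm)
      (by
        have h1 : HasDerivAt dd (-κ * d) t0 := by
          have : HasDerivAt (fun t : ℝ => Real.exp (-κ * t)) (Real.exp (-κ * t0) * (-κ * 1)) t0 :=
            ((hasDerivAt_id t0).const_mul (-κ)).exp
          refine (this.const_mul C0).congr_deriv ?_
          simp only [hd, hdd]; ring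
        have h2 : HasDerivAt qq (2 * k * q) t0 := by
          have : HasDerivAt (fun t : ℝ => Real.exp (2 * k * t))
              (Real.exp (2 * k * t0) * (2 * k * 1)) t0 :=
            ((hasDerivAt_id t0).const_mul (2 * k)).exp
          refine (this.const_mul μ).congr_deriv ?_
          simp only [hq, hqq]; ring
        have h3 : HasDerivAt (fun t => FF r0 t) (A * (e * (-(2 * k * q * r0 ^ 2)))) t0 :=
          (((h2.mul_const (r0 ^ 2)).neg.exp).const_mul A).const_add (1 - A)
        have h4 : HasDerivAt (fun t => WW r0 t) (-(-κ * d * psiB γ ε r0)) t0 :=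
          (h1.mul_const (psiB γ ε r0)).const_sub (φ r0)
        refine (h4.mul h3).congr_deriv ?_
        simp only [← hf, hWW, ← hd]; ring)
      (by
        filter_upwards [Ioo_mem_nhdsLT ht0] with t ht
        have := hgnn r0 ⟨hr0, hr0R.le⟩ t ⟨ht.1.le, ht.2.le⟩
        simp only [hg] at this
        linarith)
      heq.symm
    rw [heq] at hineq hvnn
    have hW0 : WW r0 t0 = φ r0 - d * psiB γ ε r0 := rfl
    rw [hW0] at hineq hvnn
    rw [hψeq] at hineq
    have hψp := hpsi_pos r0 hr0
    have hep : 0 < e := Real.exp_pos _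
    have he1 : e ≤ 1 := Real.exp_le_one_iff.mpr (neg_nonpos.mpr (mul_nonneg hqpos.le (sq_nonneg r0)))
    have hfe : f = 1 - A + A * e := rfl
    have hex : 1 - e ≤ q * r0 ^ 2 := hexpx _
    have hred : ∀ (hW : 0 ≤ φ r0 - d * psiB γ ε r0) (hf0 : 0 ≤ f), _ := fun hW hf0 =>
      sub_reduce (n := n) (x := q * r0 ^ 2) (k := k) hp1 h0 hqpos hA0 hep hκ hdp hφ0
        (phi_deriv_nonpos hφ h0) hψp (hφ.ode r0 h0) hψV hW hf0 (hF1 r0 t0) hineq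
    rcases le_or_gt R r0 with hRr | hRr
    · have hWp : 0 < φ r0 - d * psiB γ ε r0 := hWoutp r0 hRr t0 ht0.le
      have hfn : 0 ≤ f := by
        by_contra hc'
        push Not at hc'
        have := mul_neg_of_pos_of_neg hWp hc'
        linarith
      have hr1 := hred hWp.le hfn
      have hhalf := hWout r0 hRr t0 ht0.le
      have hout := outer_ineq (n := n) (p := p) (r := r0) (q := q) (A := A) (k := k) (γ := γ)
        (W := φ r0 - d * psiB γ ε r0) (F0 := φ r0) (D := d * psiB γ ε r0)
        (Λ := Lconst n p ^ (p - 1)) (c := c) (X0 := X0) (f := f) (e := e)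
        (e0 := Real.exp (-X0)) (f0 := 1 - A + A * Real.exp (-X0)) (x := q * r0 ^ 2)
        hp1 h0 hqpos hA rfl hγ hWp (by linarith) hφ0 (by linarith) hk hΛ
        (Real.rpow_pos_of_pos hL _)
        (by
          refine (hRc r0 hRr).trans ?_
          gcongr
          linarith) hc hep he1 hfe hfn hex hX1 hX hf0
        (by
          intro hxX
          have : Real.exp (-X0) ≤ e := Real.exp_le_exp.mpr (by linarith)
          refine ⟨this, ?_⟩
          rw [hfe]; gcongr) (Real.exp_pos _) hkb
      have hpsi' := hψo (by linarith)
      have e1 : 4 * d * ψ' r0 * q * r0 * A * e = -(4 * γ * q * A * e * (d * psiB γ ε r0)) := by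
        rw [hpsi']; field_simp
      rw [e1] at hr1
      have hpos2 : 0 ≤ κ * p * (d * psiB γ ε r0) * f *
          (φ r0 ^ (p - 1) - (φ r0 - d * psiB γ ε r0) ^ (p - 1)) := by
        have : (φ r0 - d * psiB γ ε r0) ^ (p - 1) ≤ φ r0 ^ (p - 1) :=
          Real.rpow_le_rpow hWp.le (by have := mul_pos hdp hψp; linarith) (by linarith)
        apply mul_nonneg (by positivity); linarith
      linarith
    · have hfp := hFin r0 hr0 hRr.le t0 ht0T
      have hWn : 0 ≤ φ r0 - d * psiB γ ε r0 := by
        by_contra hc'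
        push Not at hc'
        have : (φ r0 - d * psiB γ ε r0) * f < 0 := mul_neg_of_neg_of_pos hc' (by linarith)
        linarith
      have hr1 := hred hWn (by linarith)
      have hDD : D0 ≤ d * psiB γ ε r0 := by
        rw [hD0]
        have h1 : (R + 1) ^ (-γ) ≤ psiB γ ε r0 :=
          (Real.rpow_le_rpow_of_nonpos (by linarith) (by linarith) (by linarith)).trans
            (psiB_lower hγ hε hε1 hr0)
        have h2 := hddT t0 ht0T
        have h3 : 0 < (R + 1) ^ (-γ) := Real.rpow_pos_of_pos (by linarith) _
        gcongr
      have hD0p : 0 < D0 := by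
        rw [hD0]
        exact mul_pos (mul_pos hC0 (Real.exp_pos _)) (Real.rpow_pos_of_pos (by linarith) _)
      have hqle := hqT t0 ht0T
      have hsl : 0 < ε ^ (-γ) * (γ / ε) := mul_pos (Real.rpow_pos_of_pos hε _) (by positivity)
      have hin := inner_ineq (n := n) (p := p) (r := r0) (q := q) (A := A) (k := k) (κ := κ)
        (α := α) (W := φ r0 - d * psiB γ ε r0) (F0 := φ r0) (D := d * psiB γ ε r0) (D0 := D0)
        (m0 := m0) (dΨ := C0 * (ε ^ (-γ) * (γ / ε))) (dψ1 := d * ψ' r0) (R := R) (f := f)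
        (e := e) (x := q * r0 ^ 2) hp1 h0 hRr.le hqpos hA0 rfl hκ hWn
        (by have := mul_pos hdp hψp; linarith) hφ0 hφα hk hDD hD0p hm0
        (hm _ _ hφα hDD hWn) hep he1 hfe hex
        (by
          have h1 := mul_le_mul_of_nonneg_left hψs hdp.le
          have h2 := mul_le_mul_of_nonneg_right (hdd1 t0 ht0.le) hsl.le
          linarith)
        (by positivity)
        (le_trans (by gcongr) hμ1)
        (lt_of_le_of_lt (by
          have : 0 ≤ p - 1 := by linarith
          gcongr) hμ2)
      have e1 : 4 * d * ψ' r0 * q * r0 * A * e = 4 * (d * ψ' r0) * q * r0 * A * e := by ring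
      rw [e1] at hr1
      linarith


/-- Lemma 4.1: let `n > 10`, `p > p_c`, `α > 0`, and let `v₀` be continuous,
nonnegative, with `φ_α(r) − b(r+1)^{−γ} ≤ v₀(r) ≤ φ_α(r)` for all `r ≥ 0`, with `b > 0`
and `γ ∈ (ν+λ₁, (n−2)/2)`. Then there is `C > 0` such that every bounded classical radial
solution `v` with initial data `v₀` satisfies `|v(r,t) − φ_α(r)| ≤ C e^{−κ(γ)t}`. -/
theorem radial_rate_from_below (n : ℕ) (hn : 10 < n) (p α b γ : ℝ)
    (hp : pc n < p) (hα : 0 < α) (hb : 0 < b)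
    (hγ : γ ∈ Set.Ioo (nuExp p + lam1 n p) (((n : ℝ) - 2) / 2))
    (φ : ℝ → ℝ) (a : ℝ) (hφ : IsSteadyStateA n p α φ a)
    (v₀ : ℝ → ℝ) (hv₀cont : ContinuousOn v₀ (Set.Ici 0))
    (hv₀nonneg : ∀ r ≥ (0 : ℝ), 0 ≤ v₀ r)
    (hv₀low : ∀ r ≥ (0 : ℝ), φ r - b * (r + 1) ^ (-γ) ≤ v₀ r)
    (hv₀up : ∀ r ≥ (0 : ℝ), v₀ r ≤ φ r) :
    ∃ C > 0, ∀ v : ℝ → ℝ → ℝ, IsRadialSol n p v v₀ →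
      ∀ r ≥ (0 : ℝ), ∀ t ≥ (0 : ℝ),
        |v r t - φ r| ≤ C * Real.exp (-(kappaOf n p γ) * t) := by
  obtain ⟨hp1, hν, hν2⟩ := aux_params hn hp
  obtain ⟨hL, hL1, hL2⟩ := aux_L hn hp
  obtain ⟨hl, hνγ, hκ, hκγ⟩ := aux_gamma hn hp hγ
  set κ := kappaOf n p γ with hκdef
  have hγ0 : 0 < γ := by linarith
  have hn' : (11 : ℝ) ≤ n := by exact_mod_cast hn
  have hΛ : 0 < Lconst n p ^ (p - 1) := Real.rpow_pos_of_pos hL _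
  obtain ⟨ε, hε, hε1, hVε⟩ : ∃ ε : ℝ, 0 < ε ∧ ε ≤ 1 ∧
      (κ + 1) * (p * α ^ (p - 1)) * (1 + γ) * ε ^ 2 ≤ γ * ((n : ℝ) - 1) := by
    have hα' : 0 < α ^ (p - 1) := Real.rpow_pos_of_pos hα _
    have hV : 0 < (κ + 1) * (p * α ^ (p - 1)) * (1 + γ) := by positivity
    have hG : 0 < γ * ((n : ℝ) - 1) := mul_pos hγ0 (by linarith)
    refine ⟨min 1 (γ * ((n : ℝ) - 1) / ((κ + 1) * (p * α ^ (p - 1)) * (1 + γ))),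
      lt_min one_pos (div_pos hG hV), min_le_left _ _, ?_⟩
    set V := (κ + 1) * (p * α ^ (p - 1)) * (1 + γ)
    set G := γ * ((n : ℝ) - 1)
    have h0 : 0 < min 1 (G / V) := lt_min one_pos (div_pos hG hV)
    have h1 : min 1 (G / V) ≤ 1 := min_le_left _ _
    have h2 : min 1 (G / V) ≤ G / V := min_le_right _ _
    have h3 : (min 1 (G / V)) ^ 2 ≤ G / V := by
      rw [pow_two]; exact (mul_le_of_le_one_left h0.le h1).trans h2
    rw [le_div_iff₀ hV] at h3
    linarith
  have hεγ : 0 < ε ^ (-γ) := Real.rpow_pos_of_pos hε _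
  refine ⟨2 * b * (ε ^ (-γ) * (1 + γ)), by positivity, ?_⟩
  intro v hv r hr t ht
  have hub := upper_bound hn hp1 hα hL hl hφ hv₀up hv r hr t ht
  rw [abs_sub_comm, abs_of_nonneg (by linarith)]
  have hψu := psiB_upper hγ0 hε hr
  suffices hmain : φ r - 2 * b * Real.exp (-κ * t) * psiB γ ε r ≤ v r t by
    have h1 : 2 * b * Real.exp (-κ * t) * psiB γ ε r ≤
        2 * b * Real.exp (-κ * t) * (ε ^ (-γ) * (1 + γ)) := by gcongr
    linarith
  rcases ht.eq_or_lt with h0 | hT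
  · subst h0
    rw [hv.init r hr]
    have h1 := hv₀low r hr
    have h2 := psiB_lower hγ0 hε hε1 hr
    have h3 : 0 < (r + 1) ^ (-γ) := Real.rpow_pos_of_pos (by linarith) _
    have h4 := mul_le_mul_of_nonneg_left h2 hb.le
    have h5 := mul_pos hb h3
    simp only [mul_zero, Real.exp_zero, mul_one]
    linarith
  -- the far region
  obtain ⟨R, hR1, hRφ, hRc⟩ : ∃ R : ℝ, 1 ≤ R ∧ (∀ s ≥ R, 2 * b * s ^ (-γ) ≤ φ s / 2) ∧
      (∀ s ≥ R, (1 / 2 : ℝ) ^ (p - 1) * (Lconst n p / 2) ^ (p - 1) ≤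
        (φ s / 2) ^ (p - 1) * s ^ 2) := by
    have e1 := phi_lower hL hl hφ
    have e2 : ∀ᶠ s : ℝ in atTop, 2 * b * s ^ (-(γ - nuExp p)) < Lconst n p / 4 := by
      have : Tendsto (fun s : ℝ => 2 * b * s ^ (-(γ - nuExp p))) atTop (𝓝 (2 * b * 0)) :=
        (tendsto_rpow_neg_atTop (by linarith)).const_mul _
      rw [mul_zero] at this
      exact this.eventually_lt_const (by positivity)
    obtain ⟨R, hR⟩ := eventually_atTop.mp ((e1.and e2).and (eventually_ge_atTop 1))
    refine ⟨max R 1, le_max_right _ _, ?_, ?_⟩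
    · intro s hs
      obtain ⟨⟨a1, a2⟩, a3⟩ := hR s ((le_max_left _ _).trans hs)
      have hs0 : 0 < s := by linarith
      have h1 : s ^ (-γ) = s ^ (-(γ - nuExp p)) * s ^ (-nuExp p) := by
        rw [← Real.rpow_add hs0]; ring_nf
      have h2 : 0 < s ^ (-nuExp p) := Real.rpow_pos_of_pos hs0 _
      have h3 := mul_le_mul_of_nonneg_right a2.le h2.le
      rw [h1]; linarith
    · intro s hs
      obtain ⟨⟨a1, a2⟩, a3⟩ := hR s ((le_max_left _ _).trans hs)
      have hs0 : 0 < s := by linarith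
      have h1 := phi_pow_lower hp1 hL hs0 a1
      have h2 : (φ s / 2) ^ (p - 1) = (1 / 2 : ℝ) ^ (p - 1) * φ s ^ (p - 1) := by
        rw [← Real.mul_rpow (by norm_num) (hφ.pos s hs0.le).le]; congr 1; ring
      have h3 : 0 < (1 / 2 : ℝ) ^ (p - 1) := Real.rpow_pos_of_pos (by norm_num) _
      have h4 := mul_le_mul_of_nonneg_left h1 h3.le
      rw [h2]; linarith
  set c := (1 / 2 : ℝ) ^ (p - 1) * (Lconst n p / 2) ^ (p - 1) with hcdef
  have hc : 0 < c :=
    mul_pos (Real.rpow_pos_of_pos (by norm_num) _) (Real.rpow_pos_of_pos (by linarith) _)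
  obtain ⟨X0, hX1, hX⟩ : ∃ X0 : ℝ, 1 ≤ X0 ∧ Lconst n p ^ (p - 1) + 2 * γ + n < 2 * X0 :=
    ⟨Lconst n p ^ (p - 1) + 2 * γ + n + 1, by linarith, by linarith⟩
  have hE1 : Real.exp (-(X0 + 1)) < 1 := by
    have h := Real.exp_lt_exp.mpr (show -(X0 + 1) < 0 by linarith)
    rwa [Real.exp_zero] at h
  have hE0 : 0 < Real.exp (-(X0 + 1)) := Real.exp_pos _
  obtain ⟨A, hA, hAX⟩ : ∃ A : ℝ, 1 ≤ A ∧ A * Real.exp (-(X0 + 1)) = A - 1 := by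
    refine ⟨1 / (1 - Real.exp (-(X0 + 1))), ?_, ?_⟩
    · rw [le_div_iff₀ (by linarith)]; linarith
    · have : 1 - Real.exp (-(X0 + 1)) ≠ 0 := by linarith
      field_simp; ring
  have hf0 : 0 < 1 - A + A * Real.exp (-X0) := by
    have h1 : Real.exp (-(X0 + 1)) < Real.exp (-X0) := Real.exp_lt_exp.mpr (by linarith)
    have h2 := mul_lt_mul_of_pos_left h1 (show 0 < A by linarith)
    linarith
  have hf0p : 0 < (1 - A + A * Real.exp (-X0)) ^ (p - 1) := Real.rpow_pos_of_pos hf0 _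
  have hEX : 0 < Real.exp (-X0) := Real.exp_pos _
  obtain ⟨k, hk, hkb⟩ : ∃ k : ℝ, 0 < k ∧ 2 * (p - 1) * Lconst n p ^ (p - 1) + 4 * γ + 2 * n <
      2 * k * p * c * Real.exp (-X0) * (1 - A + A * Real.exp (-X0)) ^ (p - 1) := by
    set N := 2 * (p - 1) * Lconst n p ^ (p - 1) + 4 * γ + 2 * n with hN
    set F := (1 - A + A * Real.exp (-X0)) ^ (p - 1)
    have hN0 : 0 < N := by
      have : 0 < (p - 1) * Lconst n p ^ (p - 1) := mul_pos (by linarith) hΛ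
      rw [hN]; linarith
    have hp0 : 0 < p := by linarith
    refine ⟨N / (p * c * Real.exp (-X0) * F), by positivity, ?_⟩
    have : 2 * (N / (p * c * Real.exp (-X0) * F)) * p * c * Real.exp (-X0) * F = 2 * N := by
      field_simp
    rw [this]; linarith
  have hD0 : 0 < 2 * b * Real.exp (-κ * t) * (R + 1) ^ (-γ) :=
    mul_pos (by positivity) (Real.rpow_pos_of_pos (by linarith) _)
  obtain ⟨m0, hm0, hm⟩ := m0_exists hp1 hα hD0
  set D0 := 2 * b * Real.exp (-κ * t) * (R + 1) ^ (-γ) with hD0def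
  have hlim : Tendsto (fun μ : ℝ => (φ r - 2 * b * Real.exp (-κ * t) * psiB γ ε r) *
      (1 - A + A * Real.exp (-(μ * Real.exp (2 * k * t) * r ^ 2)))) (𝓝[>] 0)
      (𝓝 (φ r - 2 * b * Real.exp (-κ * t) * psiB γ ε r)) := by
    have hc1 : Continuous (fun μ : ℝ => (φ r - 2 * b * Real.exp (-κ * t) * psiB γ ε r) *
      (1 - A + A * Real.exp (-(μ * Real.exp (2 * k * t) * r ^ 2)))) := by fun_prop
    have := (hc1.tendsto 0).mono_left (nhdsWithin_le_nhds (s := Set.Ioi 0))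
    simpa using this
  have hμ1 : ∀ᶠ μ : ℝ in 𝓝[>] 0, A * ((μ * Real.exp (2 * k * t)) * R ^ 2) < 1 / 2 := by
    have hc1 : Continuous (fun μ : ℝ => A * ((μ * Real.exp (2 * k * t)) * R ^ 2)) := by fun_prop
    have := (hc1.tendsto 0).mono_left (nhdsWithin_le_nhds (s := Set.Ioi 0))
    refine this.eventually_lt_const ?_
    norm_num
  have hμ2 : ∀ᶠ μ : ℝ in 𝓝[>] 0, (μ * Real.exp (2 * k * t)) * (A * ((p - 1) * R ^ 2 * α ^ p +
      4 * (2 * b * (ε ^ (-γ) * (γ / ε))) * R + 2 * n * α)) < κ * p * D0 * m0 / 2 := by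
    have hc1 : Continuous (fun μ : ℝ => (μ * Real.exp (2 * k * t)) *
      (A * ((p - 1) * R ^ 2 * α ^ p +
      4 * (2 * b * (ε ^ (-γ) * (γ / ε))) * R + 2 * n * α))) := by fun_prop
    have := (hc1.tendsto 0).mono_left (nhdsWithin_le_nhds (s := Set.Ioi 0))
    refine this.eventually_lt_const ?_
    have : 0 < κ * p * D0 * m0 / 2 := by positivity
    simpa using this
  refine le_of_tendsto hlim ?_
  filter_upwards [hμ1, hμ2, self_mem_nhdsWithin] with μ h1 h2 h3
  exact lower_aux hn hp1 hα hL hφ hγ0 hκ hκγ hε hε1 hVε hb (by linarith) hR1 hRφ hRc hc hA hX1 hX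
    hAX hk hf0 hkb hT hD0def hm0 hm h3 h1.le h2 hv₀nonneg hv₀low hv r hr
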